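/- arXiv:2207.01715 — 2 statements merged into one kernel-verified Lean document; each statement's English description precedes it below -/
import Mathlib

section
/- Let E be a finite nonempty set and let μ be a probability measure on {0,1}^E giving positive mass to every configuration and which is monotonic: for every F ⊆ E, every e ∈ E \ F, and every pair of functions ξ, ξ' : F → {0,1} with ξ(f) ≤ ξ'(f) for all f ∈ F, one has μ(ω_e = 1 | ω|_F = ξ) ≤ μ(ω_e = 1 | ω|_F = ξ'). Let f : {0,1}^E → [0,1] be nondecreasing (for the coordinatewise partial order). Let T be any decision tree, i.e. a map assigning to every proper subset F ⊊ E and every ξ : F → {0,1} an element T(F,ξ) ∈ E \ F; running T on a configuration ω ∈ {0,1}^E produces the revealed sets F_0(ω) = ∅ and F_{t+1}(ω) = F_t(ω) ∪ {T(F_t(ω), ω|_{F_t(ω)})}, and one sets Ê(ω) = F_{τ(ω)}(ω) where τ(ω) is the smallest t such that f is constant on the set {ω' ∈ {0,1}^E : ω'|_{F_t(ω)} = ω|_{F_t(ω)}}. Then Var_μ(f) ≤ Σ_{e ∈ E} μ(e ∈ Ê) · Cov_μ(f, ω_e), where ω_e denotes the e-th coordinate viewed as a {0,1}-valued random variable.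 -/
open scoped Classical

noncomputable section

variable {E : Type*}

/-- The sets `F_t(ω)` of coordinates revealed by the decision tree `T` after `t` steps,
when run on the configuration `ω`: `F_0 = ∅` and `F_{t+1} = F_t ∪ {T(F_t, ω|_{F_t})}`. -/
def revealSeq [DecidableEq E] (T : Finset E → (E → Bool) → E) :
    ℕ → (E → Bool) → Finset E
  | 0, _ => ∅
  | t + 1, ω => revealSeq T t ω ∪ {T (revealSeq T t ω) ω}

/-- `τ(ω)`: the smallest `t` such that `f` is constant on the set of configurations
agreeing with `ω` on `F_t(ω)`. -/
def revealTime [DecidableEq E] (T : Finset E → (E → Bool) → E)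
    (f : (E → Bool) → ℝ) (ω : E → Bool) : ℕ :=
  sInf {t | ∀ ω' : E → Bool, (∀ e ∈ revealSeq T t ω, ω' e = ω e) → f ω' = f ω}

/-- `Ê(ω) = F_{τ(ω)}(ω)`: the set of coordinates revealed by the decision tree `T`
before it determines the value of `f`. -/
def revealed [DecidableEq E] (T : Finset E → (E → Bool) → E)
    (f : (E → Bool) → ℝ) (ω : E → Bool) : Finset E :=
  revealSeq T (revealTime T f ω) ω

section Conditioning

/-- The coordinate `e`, as a `{0,1}`-valued random variable. -/
def coord (e : E) (ω : E → Bool) : ℝ := if ω e then 1 else 0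

lemma coord_monotone (e : E) : Monotone (coord e) := by
  intro x y h
  have := h e
  unfold coord
  revert this
  cases x e <;> cases y e <;> simp

variable [DecidableEq E]

lemma agree_insert_update {S : Finset E} {e : E} (he : e ∉ S) (x ω : E → Bool) (b : Bool) :
    (∀ i ∈ insert e S, ω i = Function.update x e b i) ↔ ω e = b ∧ ∀ i ∈ S, ω i = x i := by
  rw [Finset.forall_mem_insert, Function.update_self]
  refine and_congr_right fun _ => forall₂_congr fun i hi => ?_
  rw [Function.update_of_ne (ne_of_mem_of_not_mem hi he)]

lemma update_le_update {S : Finset E} {e : E} {x y : E → Bool} {a b : Bool}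
    (hxy : ∀ i ∈ S, x i ≤ y i) (hab : a ≤ b) :
    ∀ i ∈ insert e S, Function.update x e a i ≤ Function.update y e b i := by
  intro i hi
  rcases eq_or_ne i e with rfl | hne
  · simpa using hab
  · simpa [Function.update_of_ne hne] using hxy i ((Finset.mem_insert.1 hi).resolve_left hne)

lemma update_le_or_le_update (y : E → Bool) (e : E) (b : Bool) :
    Function.update y e b ≤ y ∨ y ≤ Function.update y e b := by
  rw [update_le_self_iff, le_update_self_iff]
  exact le_total _ _

variable [Fintype E]

/-- The integral of `g` over the cylinder of configurations agreeing with `x` on `S`. -/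
def cylSum (μ : (E → Bool) → ℝ) (S : Finset E) (x : E → Bool) (g : (E → Bool) → ℝ) : ℝ :=
  ∑ ω : E → Bool, if ∀ e ∈ S, ω e = x e then μ ω * g ω else 0

/-- The conditional expectation of `g` given that the configuration agrees with `x` on `S`. -/
def condExpect (μ : (E → Bool) → ℝ) (S : Finset E) (x : E → Bool) (g : (E → Bool) → ℝ) : ℝ :=
  cylSum μ S x g / cylSum μ S x 1

/-- Monotonicity of `μ`: conditional probabilities of open coordinates are nondecreasing in the
conditioning. -/
def MonotonicWeight (μ : (E → Bool) → ℝ) : Prop :=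
  ∀ (F : Finset E) (e : E), e ∉ F → ∀ x y : E → Bool, (∀ i ∈ F, x i ≤ y i) →
    condExpect μ F x (coord e) ≤ condExpect μ F y (coord e)

variable {μ : (E → Bool) → ℝ}

lemma cylSum_one_pos (hpos : ∀ ω, 0 < μ ω) (S : Finset E) (x : E → Bool) :
    0 < cylSum μ S x 1 := by
  refine Finset.sum_pos' (fun ω _ => ?_) ⟨x, Finset.mem_univ _, ?_⟩
  · split_ifs
    · simpa using (hpos ω).le
    · exact le_rfl
  · simpa using hpos x

lemma cylSum_congr {S : Finset E} {x y : E → Bool} (h : ∀ e ∈ S, x e = y e)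
    (g : (E → Bool) → ℝ) : cylSum μ S x g = cylSum μ S y g := by
  refine Finset.sum_congr rfl fun ω _ => ?_
  have : (∀ e ∈ S, ω e = x e) ↔ ∀ e ∈ S, ω e = y e :=
    forall₂_congr fun e he => by rw [h e he]
  simp only [this]

lemma condExpect_congr {S : Finset E} {x y : E → Bool} (h : ∀ e ∈ S, x e = y e)
    (g : (E → Bool) → ℝ) : condExpect μ S x g = condExpect μ S y g := by
  simp only [condExpect, cylSum_congr h]

lemma cylSum_mono (hpos : ∀ ω, 0 < μ ω) {S : Finset E} {x : E → Bool} {g h : (E → Bool) → ℝ}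
    (hgh : ∀ ω, (∀ e ∈ S, ω e = x e) → g ω ≤ h ω) : cylSum μ S x g ≤ cylSum μ S x h := by
  refine Finset.sum_le_sum fun ω _ => ?_
  split_ifs with hω
  · exact mul_le_mul_of_nonneg_left (hgh ω hω) (hpos ω).le
  · exact le_rfl

lemma condExpect_mono (hpos : ∀ ω, 0 < μ ω) {S : Finset E} {x : E → Bool}
    {g h : (E → Bool) → ℝ} (hgh : ∀ ω, (∀ e ∈ S, ω e = x e) → g ω ≤ h ω) :
    condExpect μ S x g ≤ condExpect μ S x h :=
  div_le_div_of_nonneg_right (cylSum_mono hpos hgh) (cylSum_one_pos hpos S x).le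

lemma condExpect_eq_of_forall (hpos : ∀ ω, 0 < μ ω) {S : Finset E} {x : E → Bool}
    {g : (E → Bool) → ℝ} {a : ℝ} (h : ∀ ω, (∀ e ∈ S, ω e = x e) → g ω = a) :
    condExpect μ S x g = a := by
  rw [condExpect, div_eq_iff (cylSum_one_pos hpos S x).ne', cylSum, cylSum, Finset.mul_sum]
  refine Finset.sum_congr rfl fun ω _ => ?_
  split_ifs with hω
  · rw [h ω hω, Pi.one_apply]; ring
  · simp

lemma condExpect_empty (hsum : ∑ ω, μ ω = 1) (x : E → Bool) (g : (E → Bool) → ℝ) :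
    condExpect μ ∅ x g = ∑ ω, μ ω * g ω := by
  simp [condExpect, cylSum, hsum]

lemma condExpect_univ (hpos : ∀ ω, 0 < μ ω) (x : E → Bool) (g : (E → Bool) → ℝ) :
    condExpect μ Finset.univ x g = g x :=
  condExpect_eq_of_forall hpos fun ω hω => by
    rw [funext fun e => hω e (Finset.mem_univ e)]

lemma condExpect_add (S : Finset E) (x : E → Bool) (g h : (E → Bool) → ℝ) :
    condExpect μ S x (fun ω => g ω + h ω) = condExpect μ S x g + condExpect μ S x h := by
  simp only [condExpect, cylSum, ← add_div, ← Finset.sum_add_distrib]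
  congr 1
  refine Finset.sum_congr rfl fun ω _ => ?_
  split_ifs <;> ring

lemma condExpect_nonneg (hpos : ∀ ω, 0 < μ ω) (S : Finset E) (x : E → Bool)
    {g : (E → Bool) → ℝ} (hg : ∀ ω, 0 ≤ g ω) : 0 ≤ condExpect μ S x g :=
  (condExpect_eq_of_forall (g := 0) hpos fun _ _ => rfl).ge.trans
    (condExpect_mono hpos fun ω _ => hg ω)

lemma condExpect_coord_nonneg (hpos : ∀ ω, 0 < μ ω) (S : Finset E) (x : E → Bool) (e : E) :
    0 ≤ condExpect μ S x (coord e) :=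
  condExpect_nonneg hpos S x fun ω => by unfold coord; split_ifs <;> norm_num

lemma condExpect_coord_le_one (hpos : ∀ ω, 0 < μ ω) (S : Finset E) (x : E → Bool) (e : E) :
    condExpect μ S x (coord e) ≤ 1 := by
  rw [← condExpect_eq_of_forall (a := 1) (g := 1) hpos (S := S) (x := x) fun _ _ => rfl]
  refine condExpect_mono hpos fun ω _ => ?_
  simp only [coord, Pi.one_apply]
  split_ifs <;> norm_num

lemma cylSum_split {S : Finset E} {e : E} (he : e ∉ S) (x : E → Bool) (g : (E → Bool) → ℝ) :
    cylSum μ S x g = cylSum μ (insert e S) (Function.update x e true) g +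
      cylSum μ (insert e S) (Function.update x e false) g := by
  simp only [cylSum, agree_insert_update he, ← Finset.sum_add_distrib]
  refine Finset.sum_congr rfl fun ω _ => ?_
  cases ω e <;> simp

lemma cylSum_coord {S : Finset E} {e : E} (he : e ∉ S) (x : E → Bool) (g : (E → Bool) → ℝ) :
    cylSum μ S x (fun ω => g ω * coord e ω) =
      cylSum μ (insert e S) (Function.update x e true) g := by
  simp only [cylSum, agree_insert_update he]
  refine Finset.sum_congr rfl fun ω _ => ?_
  cases h : ω e <;> simp [coord, h]

lemma condExpect_mul_coord (hpos : ∀ ω, 0 < μ ω) {S : Finset E} {e : E} (he : e ∉ S)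
    (x : E → Bool) (g : (E → Bool) → ℝ) :
    condExpect μ S x (fun ω => g ω * coord e ω) = condExpect μ S x (coord e) *
      condExpect μ (insert e S) (Function.update x e true) g := by
  have h1 : cylSum μ S x (coord e) = cylSum μ (insert e S) (Function.update x e true) 1 := by
    rw [← cylSum_coord he]; simp
  have := (cylSum_one_pos hpos (insert e S) (Function.update x e true)).ne'
  have := (cylSum_one_pos hpos S x).ne'
  simp only [condExpect, cylSum_coord he, h1]
  field_simp

lemma condExpect_split (hpos : ∀ ω, 0 < μ ω) {S : Finset E} {e : E} (he : e ∉ S)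
    (x : E → Bool) (g : (E → Bool) → ℝ) :
    condExpect μ S x g =
      condExpect μ S x (coord e) * condExpect μ (insert e S) (Function.update x e true) g +
      (1 - condExpect μ S x (coord e)) *
        condExpect μ (insert e S) (Function.update x e false) g := by
  have h1 : cylSum μ S x (coord e) = cylSum μ (insert e S) (Function.update x e true) 1 := by
    rw [← cylSum_coord he]; simp
  have h2 := cylSum_split (μ := μ) he x 1
  have p1 := cylSum_one_pos hpos (insert e S) (Function.update x e true)
  have p0 := cylSum_one_pos hpos (insert e S) (Function.update x e false)
  simp only [condExpect, h1, h2, cylSum_split he x g]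
  have := p1.ne'
  have := p0.ne'
  have := (add_pos p1 p0).ne'
  field_simp
  ring

/-- Induction on the conditioning set `S`, from `S = univ` downwards. -/
lemma insert_induction {p : Finset E → Prop} (huniv : p Finset.univ)
    (hins : ∀ (S : Finset E) (e : E), e ∉ S → p (insert e S) → p S) (S : Finset E) : p S := by
  suffices ∀ R : Finset E, p Rᶜ by simpa using this Sᶜ
  intro R
  induction R using Finset.induction_on with
  | empty => simpa using huniv
  | insert e R he ih =>
    refine hins _ e (by simp) ?_
    convert ih using 1
    ext i
    rcases eq_or_ne i e with rfl | hne <;> simp [*]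

lemma condExpect_monotone (hpos : ∀ ω, 0 < μ ω) (hmono : MonotonicWeight μ)
    {g : (E → Bool) → ℝ} (hg : Monotone g) (S : Finset E) :
    ∀ {x y : E → Bool}, (∀ e ∈ S, x e ≤ y e) → condExpect μ S x g ≤ condExpect μ S y g := by
  induction S using insert_induction with
  | huniv =>
    intro x y h
    rw [condExpect_univ hpos, condExpect_univ hpos]
    exact hg fun e => h e (Finset.mem_univ e)
  | hins S e he ih =>
    intro x y h
    rw [condExpect_split hpos he x, condExpect_split hpos he y]
    have hc := hmono S e he x y h
    have h1 := ih (update_le_update (e := e) h (le_refl true))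
    have h0 := ih (update_le_update (e := e) h (le_refl false))
    have h10 := ih (update_le_update (e := e) (fun i (_ : i ∈ S) => le_refl (y i))
      (Bool.false_le true))
    nlinarith [condExpect_coord_nonneg hpos S x e, condExpect_coord_le_one hpos S x e,
      mul_nonneg (condExpect_coord_nonneg hpos S x e) (sub_nonneg.2 h1),
      mul_nonneg (sub_nonneg.2 (condExpect_coord_le_one hpos S x e)) (sub_nonneg.2 h0),
      mul_nonneg (sub_nonneg.2 hc) (sub_nonneg.2 h10)]

/-- The FKG inequality for monotonic measures, conditionally on a cylinder. -/
lemma condExpect_mul_le (hpos : ∀ ω, 0 < μ ω) (hmono : MonotonicWeight μ)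
    {g h : (E → Bool) → ℝ} (hg : Monotone g) (hh : Monotone h) (S : Finset E) :
    ∀ x : E → Bool, condExpect μ S x g * condExpect μ S x h ≤
      condExpect μ S x (fun ω => g ω * h ω) := by
  induction S using insert_induction with
  | huniv => intro x; simp only [condExpect_univ hpos, le_refl]
  | hins S e he ih =>
    intro x
    rw [condExpect_split hpos he x, condExpect_split hpos he x h,
      condExpect_split hpos he x fun ω => g ω * h ω]
    have c0 := condExpect_coord_nonneg hpos S x e
    have c1 := sub_nonneg.2 (condExpect_coord_le_one hpos S x e)
    have hle := update_le_update (e := e) (fun i (_ : i ∈ S) => le_refl (x i))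
      (Bool.false_le true)
    have hg' := sub_nonneg.2 (condExpect_monotone hpos hmono hg _ hle)
    have hh' := sub_nonneg.2 (condExpect_monotone hpos hmono hh _ hle)
    nlinarith [mul_le_mul_of_nonneg_left (ih (Function.update x e true)) c0,
      mul_le_mul_of_nonneg_left (ih (Function.update x e false)) c1,
      mul_nonneg (mul_nonneg c0 c1) (mul_nonneg hg' hh')]

/-- Averaging a conditional expectation against a function of the conditioning variables. -/
lemma sum_mul_condExpect (hpos : ∀ ω, 0 < μ ω) (S : Finset E) (g : (E → Bool) → ℝ)
    {φ : (E → Bool) → ℝ} (hφ : ∀ x y : E → Bool, (∀ e ∈ S, x e = y e) → φ x = φ y) :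
    ∑ y, μ y * (φ y * condExpect μ S y g) = ∑ y, μ y * (φ y * g y) := by
  have expand : ∀ y, μ y * (φ y * condExpect μ S y g) = ∑ z,
      if ∀ e ∈ S, z e = y e then μ z * (φ z * g z) * (μ y / cylSum μ S z 1) else 0 := by
    intro y
    rw [condExpect, cylSum, mul_div_assoc', mul_div_assoc', Finset.mul_sum, Finset.mul_sum,
      Finset.sum_div]
    refine Finset.sum_congr rfl fun z _ => ?_
    split_ifs with h
    · rw [hφ z y h, cylSum_congr h 1]; ring
    · simp
  simp only [expand]
  rw [Finset.sum_comm]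
  refine Finset.sum_congr rfl fun z _ => ?_
  have hz := (cylSum_one_pos hpos S z).ne'
  calc _ = μ z * (φ z * g z) * (cylSum μ S z 1 / cylSum μ S z 1) := by
        nth_rewrite 2 [cylSum]
        rw [Finset.sum_div, Finset.mul_sum]
        refine Finset.sum_congr rfl fun y _ => ?_
        have : (∀ e ∈ S, z e = y e) ↔ ∀ e ∈ S, y e = z e :=
          forall₂_congr fun _ _ => eq_comm
        simp only [this]
        split_ifs <;> simp
    _ = _ := by rw [div_self hz, mul_one]

end Conditioning

section Sampling

lemma exists_quantile_weight (P : Finset ℝ) (hP : ∀ p ∈ P, 0 ≤ p) :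
    ∃ w : ℝ → ℝ, (∀ k, 0 ≤ w k) ∧
      ∀ p ∈ P, ∑ k ∈ P, w k * (if k ≤ p then 1 else 0) = p := by
  induction P using Finset.induction_on_max with
  | empty => exact ⟨0, fun _ => le_rfl, by simp⟩
  | insert a P ha ih =>
    obtain ⟨w, hw0, hw⟩ := ih fun p hp => hP p (Finset.mem_insert_of_mem hp)
    have haP : a ∉ P := fun h => lt_irrefl _ (ha a h)
    have htotal : ∑ k ∈ P, w k ≤ a := by
      rcases P.eq_empty_or_nonempty with rfl | hne
      · simpa using hP a (by simp)
      · refine le_trans (le_of_eq ?_) (ha _ (P.max'_mem hne)).le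
        rw [← hw _ (P.max'_mem hne)]
        exact Finset.sum_congr rfl fun k hk => by simp [P.le_max' k hk]
    have hup : ∀ g : ℝ → ℝ, ∑ k ∈ P, Function.update w a (a - ∑ k ∈ P, w k) k * g k =
        ∑ k ∈ P, w k * g k := fun g =>
      Finset.sum_congr rfl fun k hk => by
        rw [Function.update_of_ne (ne_of_mem_of_not_mem hk haP)]
    refine ⟨Function.update w a (a - ∑ k ∈ P, w k), fun k => ?_, fun p hp => ?_⟩
    · rcases eq_or_ne k a with rfl | hne
      · simpa using htotal
      · simpa [Function.update_of_ne hne] using hw0 k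
    · rw [Finset.sum_insert haP, hup, Function.update_self]
      rcases Finset.mem_insert.1 hp with rfl | hp
      · have : ∑ k ∈ P, w k * (if k ≤ p then 1 else 0) = ∑ k ∈ P, w k :=
          Finset.sum_congr rfl fun k hk => by simp [(ha k hk).le]
        rw [this]
        simp
      · rw [hw p hp]
        simp [(ha p hp).not_ge]

variable [DecidableEq E] [Fintype E]

/-- A finitely supported discretisation of a uniform random variable on `[0,1]`, fine enough to
sample every one-coordinate conditional law of `μ` by thresholding. -/
structure Sampler (μ : (E → Bool) → ℝ) where
  support : Finset ℝ
  weight : ℝ → ℝ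
  weight_nonneg : ∀ k, 0 ≤ weight k
  sum_weight : ∑ k ∈ support, weight k = 1
  sum_threshold : ∀ (S : Finset E) (x : E → Bool) (e : E),
    ∑ k ∈ support, weight k * (if k ≤ condExpect μ S x (coord e) then 1 else 0) =
      condExpect μ S x (coord e)

variable {μ : (E → Bool) → ℝ}

lemma nonempty_sampler (hpos : ∀ ω, 0 < μ ω) : Nonempty (Sampler μ) := by
  let c : Finset E × (E → Bool) × E → ℝ := fun i => condExpect μ i.1 i.2.1 (coord i.2.2)
  have hmem : ∀ p, p ∈ insert 1 (Finset.univ.image c) ↔ p = 1 ∨ ∃ i, c i = p := by simp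
  obtain ⟨w, hw0, hw⟩ := exists_quantile_weight (insert 1 (Finset.univ.image c)) (by
    intro p hp
    rcases (hmem p).1 hp with rfl | ⟨i, rfl⟩
    · exact zero_le_one
    · exact condExpect_coord_nonneg hpos _ _ _)
  refine ⟨⟨_, w, hw0, ?_, fun S x e => hw _ ((hmem _).2 (Or.inr ⟨(S, x, e), rfl⟩))⟩⟩
  refine Eq.trans (Finset.sum_congr rfl fun k hk => ?_) (hw 1 ((hmem 1).2 (Or.inl rfl)))
  have : k ≤ 1 := by
    rcases (hmem k).1 hk with rfl | ⟨i, rfl⟩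
    · exact le_rfl
    · exact condExpect_coord_le_one hpos _ _ _
  simp [this]

namespace Sampler

variable (s : Sampler μ)

/-- The expectation of a function of one sample. -/
def avg (g : ℝ → ℝ) : ℝ := ∑ k ∈ s.support, s.weight k * g k

/-- The expectation of a function of `n` independent samples. -/
def listAvg : ℕ → (List ℝ → ℝ) → ℝ
  | 0, G => G []
  | n + 1, G => s.avg fun k => listAvg n fun l => G (k :: l)

lemma avg_mono {g h : ℝ → ℝ} (hgh : ∀ k, g k ≤ h k) : s.avg g ≤ s.avg h :=
  Finset.sum_le_sum fun k _ => mul_le_mul_of_nonneg_left (hgh k) (s.weight_nonneg k)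

lemma avg_const (a : ℝ) : s.avg (fun _ => a) = a := by
  rw [avg, ← Finset.sum_mul, s.sum_weight, one_mul]

lemma avg_add (g h : ℝ → ℝ) : s.avg (fun k => g k + h k) = s.avg g + s.avg h := by
  simp only [avg, mul_add, Finset.sum_add_distrib]

lemma avg_sum {ι : Type*} (t : Finset ι) (a : ι → ℝ) (g : ι → ℝ → ℝ) :
    s.avg (fun k => ∑ i ∈ t, a i * g i k) = ∑ i ∈ t, a i * s.avg (g i) := by
  simp only [avg, Finset.mul_sum]
  rw [Finset.sum_comm]
  exact Finset.sum_congr rfl fun _ _ => Finset.sum_congr rfl fun _ _ => by ring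

lemma avg_decide (S : Finset E) (x : E → Bool) (e : E) (G : Bool → ℝ) :
    s.avg (fun k => G (decide (k ≤ condExpect μ S x (coord e)))) =
      condExpect μ S x (coord e) * G true + (1 - condExpect μ S x (coord e)) * G false := by
  have : ∀ k, s.weight k * G (decide (k ≤ condExpect μ S x (coord e))) =
      s.weight k * (if k ≤ condExpect μ S x (coord e) then 1 else 0) * (G true - G false) +
        s.weight k * G false := by
    intro k
    split_ifs with h <;> simp [h]
    ring
  simp only [avg, this]
  rw [Finset.sum_add_distrib, ← Finset.sum_mul, ← Finset.sum_mul, s.sum_threshold, s.sum_weight]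
  ring

lemma listAvg_mono (n : ℕ) : ∀ {G H : List ℝ → ℝ}, (∀ l, G l ≤ H l) →
    s.listAvg n G ≤ s.listAvg n H := by
  induction n with
  | zero => exact fun h => h []
  | succ n ih => exact fun h => s.avg_mono fun k => ih fun l => h (k :: l)

lemma listAvg_const (n : ℕ) (a : ℝ) : s.listAvg n (fun _ => a) = a := by
  induction n with
  | zero => rfl
  | succ n ih => simp only [listAvg, ih, avg_const]

lemma listAvg_add (n : ℕ) : ∀ G H : List ℝ → ℝ,
    s.listAvg n (fun l => G l + H l) = s.listAvg n G + s.listAvg n H := by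
  induction n with
  | zero => exact fun _ _ => rfl
  | succ n ih => intro G H; simp only [listAvg, ih, avg_add]

lemma listAvg_sum {ι : Type*} (t : Finset ι) (a : ι → ℝ) (n : ℕ) : ∀ G : ι → List ℝ → ℝ,
    s.listAvg n (fun l => ∑ i ∈ t, a i * G i l) = ∑ i ∈ t, a i * s.listAvg n (G i) := by
  induction n with
  | zero => exact fun _ => rfl
  | succ n ih => intro G; simp only [listAvg, ih, avg_sum]

lemma listAvg_sub (n : ℕ) (G H : List ℝ → ℝ) :
    s.listAvg n (fun l => G l - H l) = s.listAvg n G - s.listAvg n H := by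
  rw [eq_sub_iff_add_eq, ← listAvg_add]
  simp only [sub_add_cancel]

end Sampler

end Sampling

section DecisionTree

/-- The value of `f` is determined by the values of `x` on `S`. -/
def Determined (f : (E → Bool) → ℝ) (S : Finset E) (x : E → Bool) : Prop :=
  ∀ ω : E → Bool, (∀ e ∈ S, ω e = x e) → f ω = f x

lemma determined_congr {f : (E → Bool) → ℝ} {S : Finset E} {x y : E → Bool}
    (h : ∀ e ∈ S, x e = y e) : Determined f S x ↔ Determined f S y := by
  have key : ∀ {x y : E → Bool}, (∀ e ∈ S, x e = y e) → Determined f S x → Determined f S y :=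
    fun h hx ω hω => by
      rw [hx ω fun e he => (hω e he).trans (h e he).symm, hx _ fun e he => (h e he).symm]
  exact ⟨key h, key fun e he => (h e he).symm⟩

lemma determined_univ [Fintype E] {f : (E → Bool) → ℝ} (x : E → Bool) : Determined f Finset.univ x :=
  fun ω hω => by rw [funext fun e => hω e (Finset.mem_univ e)]

lemma not_mem_of_not_determined [Fintype E] {T : Finset E → (E → Bool) → E}
    {f : (E → Bool) → ℝ} (hT : ∀ F : Finset E, F ≠ Finset.univ → ∀ ξ, T F ξ ∉ F)
    {S : Finset E} {x : E → Bool} (h : ¬Determined f S x) : T S x ∉ S :=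
  hT S (fun hS => h (hS ▸ determined_univ x)) x

variable [DecidableEq E]

/-- The coordinates queried on `ω` during the next `n` steps, when `S` is already revealed. -/
def queries (T : Finset E → (E → Bool) → E) (f : (E → Bool) → ℝ) :
    ℕ → Finset E → (E → Bool) → Finset E
  | 0, _, _ => ∅
  | n + 1, S, ω =>
    if Determined f S ω then ∅ else insert (T S ω) (queries T f n (insert (T S ω) S) ω)

variable {T : Finset E → (E → Bool) → E} {f : (E → Bool) → ℝ}

lemma queries_subset_revealed {ω : E → Bool}
    (hτ : Determined f (revealSeq T (revealTime T f ω) ω) ω) (n : ℕ) :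
    ∀ t, t ≤ revealTime T f ω → queries T f n (revealSeq T t ω) ω ⊆ revealed T f ω := by
  have hmono : Monotone fun t => revealSeq T t ω :=
    monotone_nat_of_le_succ fun t => Finset.subset_union_left
  induction n with
  | zero => simp [queries]
  | succ n ih =>
    intro t ht
    rw [queries]
    split_ifs with hdet
    · exact Finset.empty_subset _
    · have hlt : t + 1 ≤ revealTime T f ω :=
        lt_of_le_of_ne ht fun h => hdet (by rw [h]; exact hτ)
      have hsucc : insert (T (revealSeq T t ω) ω) (revealSeq T t ω) =
          revealSeq T (t + 1) ω := by
        rw [revealSeq, Finset.insert_eq, Finset.union_comm]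
      rw [hsucc]
      refine Finset.insert_subset (hmono hlt ?_) (ih _ hlt)
      simp [revealSeq]

variable [Fintype E]

lemma determined_revealTime (hT : ∀ F : Finset E, F ≠ Finset.univ → ∀ ξ, T F ξ ∉ F)
    (ω : E → Bool) : Determined f (revealSeq T (revealTime T f ω) ω) ω := by
  have hcard : ∀ t, revealSeq T t ω = Finset.univ ∨ t ≤ (revealSeq T t ω).card := by
    intro t
    induction t with
    | zero => exact Or.inr (Nat.zero_le _)
    | succ t ih =>
      rw [revealSeq]
      by_cases h : revealSeq T t ω = Finset.univ
      · exact Or.inl (by simp [h])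
      · right
        rw [Finset.card_union_of_disjoint (by simpa using hT _ h ω), Finset.card_singleton]
        exact Nat.succ_le_succ (ih.resolve_left h)
  have huniv : revealSeq T (Fintype.card E) ω = Finset.univ :=
    (hcard _).elim id fun h => Finset.eq_univ_of_card _ (le_antisymm (Finset.card_le_univ _) h)
  exact Nat.sInf_mem (s := {t | Determined f (revealSeq T t ω) ω})
    ⟨Fintype.card E, by simpa [huniv] using determined_univ ω⟩

lemma not_mem_queries (hT : ∀ F : Finset E, F ≠ Finset.univ → ∀ ξ, T F ξ ∉ F) (ω : E → Bool)
    (n : ℕ) : ∀ {S : Finset E} {e : E}, e ∈ S → e ∉ queries T f n S ω := by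
  induction n with
  | zero => simp [queries]
  | succ n ih =>
    intro S e he
    rw [queries]
    split_ifs with hdet
    · simp
    · have hne := ne_of_mem_of_not_mem he (not_mem_of_not_determined hT hdet)
      simpa [hne] using ih (Finset.mem_insert_of_mem he)

end DecisionTree

section Resampling

variable [DecidableEq E] [Fintype E]

/-- The covariance of `f` and the coordinate `e` under `μ`. -/
def coordCov (μ : (E → Bool) → ℝ) (f : (E → Bool) → ℝ) (e : E) : ℝ :=
  (∑ ω, μ ω * (f ω * coord e ω)) - (∑ ω, μ ω * f ω) * ∑ ω, μ ω * coord e ω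

/-- `y`, with the coordinate `e` resampled from its conditional law given `y` on `S`, using the
uniform sample `k`. -/
def resample (μ : (E → Bool) → ℝ) (S : Finset E) (e : E) (k : ℝ) (y : E → Bool) : E → Bool :=
  Function.update y e (decide (k ≤ condExpect μ S y (coord e)))

/-- The decision tree is run on the configuration `x`, while `x` and `y` (both known on `S`) are
sampled with the same uniform samples `l`. The result is the conditional expectation of `f` given
the values of `y` revealed when the tree stops. -/
def coupledRun (μ : (E → Bool) → ℝ) (T : Finset E → (E → Bool) → E) (f : (E → Bool) → ℝ) :
    List ℝ → Finset E → (E → Bool) → (E → Bool) → ℝ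
  | [], S, _, y => condExpect μ S y f
  | k :: l, S, x, y =>
    if Determined f S x then condExpect μ S y f
    else coupledRun μ T f l (insert (T S x) S) (resample μ S (T S x) k x)
      (resample μ S (T S x) k y)

variable {μ : (E → Bool) → ℝ} {f : (E → Bool) → ℝ} {T : Finset E → (E → Bool) → E}

lemma coordCov_nonneg (hpos : ∀ ω, 0 < μ ω) (hsum : ∑ ω, μ ω = 1) (hmono : MonotonicWeight μ)
    (hf : Monotone f) (e : E) : 0 ≤ coordCov μ f e := by
  have := condExpect_mul_le hpos hmono hf (coord_monotone e) ∅ fun _ => true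
  simp only [condExpect_empty hsum] at this
  exact sub_nonneg.2 this

lemma coupledRun_mono (hpos : ∀ ω, 0 < μ ω) (hmono : MonotonicWeight μ) (hf : Monotone f)
    (hT : ∀ F : Finset E, F ≠ Finset.univ → ∀ ξ, T F ξ ∉ F) (l : List ℝ) :
    ∀ (S : Finset E) (x : E → Bool) {y z : E → Bool}, (∀ i ∈ S, y i ≤ z i) →
      coupledRun μ T f l S x y ≤ coupledRun μ T f l S x z := by
  induction l with
  | nil => exact fun S x y z h => condExpect_monotone hpos hmono hf S h
  | cons k l ih =>
    intro S x y z h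
    simp only [coupledRun]
    split_ifs with hdet
    · exact condExpect_monotone hpos hmono hf S h
    · refine ih _ _ (update_le_update h ?_)
      have hc := hmono S _ (not_mem_of_not_determined hT hdet) y z h
      by_cases hk : k ≤ condExpect μ S y (coord (T S x))
      · simp [hk, hk.trans hc]
      · simp [hk]

variable (s : Sampler μ)

lemma avg_condExpect_resample (hpos : ∀ ω, 0 < μ ω) {S : Finset E} {e : E} (he : e ∉ S)
    (y : E → Bool) (g : (E → Bool) → ℝ) :
    s.avg (fun k => condExpect μ (insert e S) (resample μ S e k y) g) = condExpect μ S y g := by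
  rw [condExpect_split hpos he]
  exact s.avg_decide S y e fun b => condExpect μ (insert e S) (Function.update y e b) g

lemma listAvg_coupledRun (hpos : ∀ ω, 0 < μ ω)
    (hT : ∀ F : Finset E, F ≠ Finset.univ → ∀ ξ, T F ξ ∉ F) (n : ℕ) :
    ∀ (S : Finset E) (x y : E → Bool),
      s.listAvg n (fun l => coupledRun μ T f l S x y) = condExpect μ S y f := by
  induction n with
  | zero => exact fun _ _ _ => rfl
  | succ n ih =>
    intro S x y
    simp only [Sampler.listAvg, coupledRun]
    split_ifs with hdet
    · simp only [Sampler.listAvg_const, Sampler.avg_const]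
    · simp only [ih]
      exact avg_condExpect_resample s hpos (not_mem_of_not_determined hT hdet) y f

lemma listAvg_abs_coupledRun_sub (hpos : ∀ ω, 0 < μ ω) (hmono : MonotonicWeight μ)
    (hf : Monotone f) (hT : ∀ F : Finset E, F ≠ Finset.univ → ∀ ξ, T F ξ ∉ F) (n : ℕ)
    (S : Finset E) (x : E → Bool) {y z : E → Bool} (h : y ≤ z ∨ z ≤ y) :
    s.listAvg n (fun l => |coupledRun μ T f l S x y - coupledRun μ T f l S x z|) =
      |condExpect μ S y f - condExpect μ S z f| := by
  wlog hzy : z ≤ y generalizing y z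
  · simpa only [abs_sub_comm] using this h.symm (h.resolve_right hzy)
  have hle : ∀ i ∈ S, z i ≤ y i := fun i _ => hzy i
  rw [abs_of_nonneg (sub_nonneg.2 (condExpect_monotone hpos hmono hf S hle)),
    ← listAvg_coupledRun s hpos hT n S x y, ← listAvg_coupledRun s hpos hT n S x z,
    ← s.listAvg_sub]
  congr 1
  funext l
  exact abs_of_nonneg (sub_nonneg.2 (coupledRun_mono hpos hmono hf hT l S x hle))

/-- Resampling the coordinate `e` changes the conditional expectation of `f` by twice the
covariance of `f` and the coordinate `e` at most, on average. -/
lemma sum_avg_abs_resample_le (hpos : ∀ ω, 0 < μ ω) (hsum : ∑ ω, μ ω = 1)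
    (hmono : MonotonicWeight μ) (hf : Monotone f) {S : Finset E} {e : E} (he : e ∉ S) :
    ∑ y, μ y * s.avg (fun k => |condExpect μ (insert e S) (resample μ S e k y) f -
      condExpect μ (insert e S) y f|) ≤ 2 * coordCov μ f e := by
  set c : (E → Bool) → ℝ := fun y => condExpect μ S y (coord e)
  set a : (E → Bool) → ℝ := fun y => condExpect μ (insert e S) (Function.update y e true) f
  set b : (E → Bool) → ℝ := fun y => condExpect μ (insert e S) (Function.update y e false) f
  have hupd : ∀ (v : Bool) {x y : E → Bool}, (∀ i ∈ S, x i = y i) →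
      ∀ i ∈ insert e S, Function.update x e v i = Function.update y e v i :=
    fun v x y h i hi => le_antisymm
      (update_le_update (fun j hj => (h j hj).le) (le_refl v) i hi)
      (update_le_update (fun j hj => (h j hj).ge) (le_refl v) i hi)
  have step : ∀ y, s.avg (fun k => |condExpect μ (insert e S) (resample μ S e k y) f -
      condExpect μ (insert e S) y f|) =
        (1 - 2 * c y) * (a y - b y) * coord e y + c y * (a y - b y) := by
    intro y
    have hab : b y ≤ a y := condExpect_monotone hpos hmono hf _
      (update_le_update (fun i (_ : i ∈ S) => le_refl (y i)) (Bool.false_le true))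
    refine (s.avg_decide S y e fun v => |condExpect μ (insert e S) (Function.update y e v) f -
      condExpect μ (insert e S) y f|).trans ?_
    change c y * |a y - _| + (1 - c y) * |b y - _| = _
    cases hy : y e
    · have : condExpect μ (insert e S) y f = b y := by
        simp only [b, ← hy, Function.update_eq_self]
      rw [this, abs_of_nonneg (sub_nonneg.2 hab)]
      simp [coord, hy]
    · have : condExpect μ (insert e S) y f = a y := by
        simp only [a, ← hy, Function.update_eq_self]
      rw [this, abs_sub_comm (b y), abs_of_nonneg (sub_nonneg.2 hab)]
      simp [coord, hy]
      ring
  have hcond : ∀ y, (1 - 2 * c y) * (a y - b y) * c y + c y * (a y - b y) =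
      2 * (condExpect μ S y (fun ω => f ω * coord e ω) - condExpect μ S y f * c y) := by
    intro y
    rw [condExpect_mul_coord hpos he, condExpect_split hpos he y f]
    ring
  have hfkg := condExpect_mul_le hpos hmono
    (g := fun y => condExpect μ S y f) (h := c)
    (fun x y h => condExpect_monotone hpos hmono hf S fun i _ => h i)
    (fun x y h => condExpect_monotone hpos hmono (coord_monotone e) S fun i _ => h i)
    ∅ (fun _ => true)
  simp only [condExpect_empty hsum] at hfkg
  have htower : ∀ g : (E → Bool) → ℝ, ∑ y, μ y * condExpect μ S y g = ∑ y, μ y * g y := by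
    intro g
    simpa using sum_mul_condExpect hpos S g (φ := fun _ => 1) fun _ _ _ => rfl
  calc _ = ∑ y, μ y * ((1 - 2 * c y) * (a y - b y) * coord e y) +
        ∑ y, μ y * (c y * (a y - b y)) := by
        simp only [step, mul_add, Finset.sum_add_distrib]
    _ = ∑ y, μ y * ((1 - 2 * c y) * (a y - b y) * c y) + ∑ y, μ y * (c y * (a y - b y)) := by
        rw [sum_mul_condExpect hpos S (coord e) (φ := fun y => (1 - 2 * c y) * (a y - b y))]
        intro x y h
        simp only [c, a, b, condExpect_congr h, condExpect_congr (hupd _ h)]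
    _ = 2 * (∑ y, μ y * condExpect μ S y (fun ω => f ω * coord e ω) -
          ∑ y, μ y * (condExpect μ S y f * c y)) := by
        rw [← Finset.sum_add_distrib, ← Finset.sum_sub_distrib, Finset.mul_sum]
        refine Finset.sum_congr rfl fun y _ => ?_
        rw [← mul_add, hcond]
        ring
    _ ≤ 2 * coordCov μ f e := by
        rw [htower] at hfkg ⊢
        rw [htower] at hfkg
        unfold coordCov
        linarith

/-- When `x` is revealed on `S`, the deviation from its mean of the average of the final
conditional expectation, over `y` distributed as `μ`. -/
lemma listAvg_abs_sub_le (hpos : ∀ ω, 0 < μ ω) (hsum : ∑ ω, μ ω = 1)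
    (hmono : MonotonicWeight μ) (hf : Monotone f)
    (hT : ∀ F : Finset E, F ≠ Finset.univ → ∀ ξ, T F ξ ∉ F)
    (hTloc : ∀ (F : Finset E) (ξ ξ' : E → Bool), (∀ e ∈ F, ξ e = ξ' e) → T F ξ = T F ξ')
    (n : ℕ) : ∀ (S : Finset E) (x : E → Bool),
      s.listAvg n (fun l => |∑ y, μ y * coupledRun μ T f l S x y - ∑ y, μ y * f y|) ≤
        ∑ e, 2 * coordCov μ f e *
          condExpect μ S x (fun ω => if e ∈ queries T f n S ω then 1 else 0) := by
  have htower : ∀ S, ∑ y, μ y * condExpect μ S y f = ∑ y, μ y * f y := by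
    intro S
    simpa using sum_mul_condExpect hpos S f (φ := fun _ => 1) fun _ _ _ => rfl
  have hcov := coordCov_nonneg hpos hsum hmono hf
  have hnonneg : ∀ n S x, 0 ≤ ∑ e, 2 * coordCov μ f e *
      condExpect μ S x (fun ω => if e ∈ queries T f n S ω then 1 else 0) := by
    refine fun n S x => Finset.sum_nonneg fun e _ =>
      mul_nonneg (mul_nonneg zero_le_two (hcov e)) (condExpect_nonneg hpos S x fun ω => ?_)
    split_ifs <;> norm_num
  induction n with
  | zero =>
    intro S x
    simpa [Sampler.listAvg, coupledRun, htower] using hnonneg 0 S x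
  | succ n ih =>
    intro S x
    by_cases hdet : Determined f S x
    · simpa only [Sampler.listAvg, coupledRun, if_pos hdet, htower, sub_self, abs_zero,
        s.listAvg_const, s.avg_const] using hnonneg (n + 1) S x
    have he := not_mem_of_not_determined hT hdet
    set e₀ := T S x with he₀
    have hqueries : ∀ e, condExpect μ S x
        (fun ω => if e ∈ queries T f (n + 1) S ω then 1 else 0) = (if e = e₀ then 1 else 0) +
          condExpect μ S x (fun ω => if e ∈ queries T f n (insert e₀ S) ω then 1 else 0) := by
      intro e
      rw [← condExpect_eq_of_forall hpos (S := S) (x := x)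
        (g := fun _ => if e = e₀ then 1 else 0) fun _ _ => rfl, ← condExpect_add]
      have hind : ∀ ω, (∀ i ∈ S, ω i = x i) →
          (if e ∈ queries T f (n + 1) S ω then (1 : ℝ) else 0) = (if e = e₀ then 1 else 0) +
            (if e ∈ queries T f n (insert e₀ S) ω then 1 else 0) := by
        intro ω hω
        rw [queries, if_neg (mt (determined_congr hω).1 hdet), hTloc S ω x hω, ← he₀]
        have := not_mem_queries (f := f) hT ω n (Finset.mem_insert_self e₀ S)
        by_cases h : e = e₀
        · subst h; simp [this]
        · simp [h]
      exact le_antisymm (condExpect_mono hpos fun ω hω => (hind ω hω).le)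
        (condExpect_mono hpos fun ω hω => (hind ω hω).ge)
    calc _ ≤ s.avg fun k => s.listAvg n fun l =>
          |∑ y, μ y * coupledRun μ T f l (insert e₀ S) (resample μ S e₀ k x) y -
            ∑ y, μ y * f y| +
          ∑ y, μ y * |coupledRun μ T f l (insert e₀ S) (resample μ S e₀ k x)
              (resample μ S e₀ k y) -
            coupledRun μ T f l (insert e₀ S) (resample μ S e₀ k x) y| := by
          refine s.avg_mono fun k => s.listAvg_mono n fun l => ?_
          simp only [coupledRun, if_neg hdet, ← he₀]
          have hdiff : |∑ y, μ y * coupledRun μ T f l (insert e₀ S) (resample μ S e₀ k x)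
              (resample μ S e₀ k y) -
              ∑ y, μ y * coupledRun μ T f l (insert e₀ S) (resample μ S e₀ k x) y| ≤
              ∑ y, μ y * |coupledRun μ T f l (insert e₀ S) (resample μ S e₀ k x)
                (resample μ S e₀ k y) -
                coupledRun μ T f l (insert e₀ S) (resample μ S e₀ k x) y| := by
            rw [← Finset.sum_sub_distrib]
            refine (Finset.abs_sum_le_sum_abs _ _).trans (Finset.sum_le_sum fun y _ => ?_)
            rw [← mul_sub, abs_mul, abs_of_pos (hpos y)]
          refine (abs_sub_le _ (∑ y, μ y * coupledRun μ T f l (insert e₀ S)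
            (resample μ S e₀ k x) y) _).trans ?_
          exact (add_le_add hdiff le_rfl).trans_eq (add_comm _ _)
      _ = (s.avg fun k => s.listAvg n fun l =>
          |∑ y, μ y * coupledRun μ T f l (insert e₀ S) (resample μ S e₀ k x) y -
            ∑ y, μ y * f y|) +
          ∑ y, μ y * s.avg (fun k => |condExpect μ (insert e₀ S) (resample μ S e₀ k y) f -
            condExpect μ (insert e₀ S) y f|) := by
          simp only [s.listAvg_add, s.avg_add, s.listAvg_sum, s.avg_sum]
          simp only [listAvg_abs_coupledRun_sub s hpos hmono hf hT n _ _
            (update_le_or_le_update _ _ _), resample]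
      _ ≤ (s.avg fun k => ∑ e, 2 * coordCov μ f e * condExpect μ (insert e₀ S)
            (resample μ S e₀ k x)
            (fun ω => if e ∈ queries T f n (insert e₀ S) ω then 1 else 0)) +
          2 * coordCov μ f e₀ :=
          add_le_add (s.avg_mono fun k => ih _ _)
            (sum_avg_abs_resample_le s hpos hsum hmono hf he)
      _ = _ := by
          simp only [s.avg_sum, avg_condExpect_resample s hpos he, hqueries, mul_add,
            Finset.sum_add_distrib]
          simp [add_comm]

lemma listAvg_coupledRun_self (hpos : ∀ ω, 0 < μ ω)
    (hT : ∀ F : Finset E, F ≠ Finset.univ → ∀ ξ, T F ξ ∉ F) (φ : ℝ → ℝ) (n : ℕ) :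
    ∀ (S : Finset E) (x : E → Bool), Fintype.card E ≤ n + S.card →
      s.listAvg n (fun l => φ (coupledRun μ T f l S x x)) =
        condExpect μ S x (fun ω => φ (f ω)) := by
  have hdetermined : ∀ S x, Determined f S x →
      φ (condExpect μ S x f) = condExpect μ S x (fun ω => φ (f ω)) := fun S x h => by
    rw [condExpect_eq_of_forall hpos h, condExpect_eq_of_forall hpos fun ω hω => by rw [h ω hω]]
  induction n with
  | zero =>
    intro S x hS
    rw [zero_add] at hS
    obtain rfl := Finset.eq_univ_of_card S (le_antisymm (Finset.card_le_univ S) hS)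
    exact hdetermined _ x (determined_univ x)
  | succ n ih =>
    intro S x hS
    simp only [Sampler.listAvg, coupledRun]
    split_ifs with hdet
    · simp only [s.listAvg_const, s.avg_const, hdetermined S x hdet]
    · have he := not_mem_of_not_determined hT hdet
      have hcard : Fintype.card E ≤ n + (insert (T S x) S).card := by
        rw [Finset.card_insert_of_notMem he]; omega
      simp only [ih _ _ hcard]
      exact avg_condExpect_resample s hpos he x _

/-- The `L¹` form of the OSSS inequality. -/
lemma sum_abs_sub_mean_le (hpos : ∀ ω, 0 < μ ω) (hsum : ∑ ω, μ ω = 1)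
    (hmono : MonotonicWeight μ) (hf : Monotone f)
    (hT : ∀ F : Finset E, F ≠ Finset.univ → ∀ ξ, T F ξ ∉ F)
    (hTloc : ∀ (F : Finset E) (ξ ξ' : E → Bool), (∀ e ∈ F, ξ e = ξ' e) → T F ξ = T F ξ') :
    ∑ ω, μ ω * |f ω - ∑ y, μ y * f y| ≤
      ∑ e, 2 * coordCov μ f e * ∑ ω, if e ∈ revealed T f ω then μ ω else 0 := by
  obtain ⟨s⟩ := nonempty_sampler hpos
  let x : E → Bool := fun _ => true
  have hirrel : ∀ l y, coupledRun μ T f l ∅ x y = coupledRun μ T f l ∅ x x := fun l y =>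
    le_antisymm (coupledRun_mono hpos hmono hf hT l ∅ x (by simp))
      (coupledRun_mono hpos hmono hf hT l ∅ x (by simp))
  have hmain := listAvg_abs_sub_le s hpos hsum hmono hf hT hTloc (Fintype.card E) ∅ x
  simp only [hirrel, ← Finset.sum_mul, hsum, one_mul] at hmain
  rw [listAvg_coupledRun_self s hpos hT (fun v => |v - ∑ y, μ y * f y|) _ ∅ x (by simp)] at hmain
  simp only [condExpect_empty hsum] at hmain
  refine hmain.trans (Finset.sum_le_sum fun e _ => mul_le_mul_of_nonneg_left
    (Finset.sum_le_sum fun ω _ => ?_)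
    (mul_nonneg zero_le_two (coordCov_nonneg hpos hsum hmono hf e)))
  have hsub : queries T f (Fintype.card E) ∅ ω ⊆ revealed T f ω :=
    queries_subset_revealed (determined_revealTime hT ω) _ 0 (Nat.zero_le _)
  by_cases h : e ∈ queries T f (Fintype.card E) ∅ ω
  · simp [h, hsub h]
  · simp only [h, if_false, mul_zero]
    split_ifs
    exacts [(hpos ω).le, le_rfl]

lemma variance_le_half_sum_abs (hpos : ∀ ω, 0 < μ ω) (hsum : ∑ ω, μ ω = 1)
    (hf0 : ∀ ω, 0 ≤ f ω) (hf1 : ∀ ω, f ω ≤ 1) :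
    (∑ ω, μ ω * f ω ^ 2) - (∑ ω, μ ω * f ω) ^ 2 ≤
      (∑ ω, μ ω * |f ω - ∑ y, μ y * f y|) / 2 := by
  set m := ∑ y, μ y * f y with hm
  have hexpand : (∑ ω, μ ω * f ω ^ 2) - m ^ 2 = ∑ ω, μ ω * ((f ω - m) * (f ω - 1 / 2)) := by
    have : ∀ ω, μ ω * ((f ω - m) * (f ω - 1 / 2)) =
        μ ω * f ω ^ 2 - (m + 1 / 2) * (μ ω * f ω) + m / 2 * μ ω := fun ω => by ring
    simp only [this, Finset.sum_add_distrib, Finset.sum_sub_distrib, ← Finset.mul_sum, hsum,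
      ← hm]
    ring
  rw [hexpand, Finset.sum_div]
  refine Finset.sum_le_sum fun ω _ => ?_
  rw [mul_div_assoc]
  refine mul_le_mul_of_nonneg_left ?_ (hpos ω).le
  have hhalf : |f ω - 1 / 2| ≤ 1 / 2 := abs_le.2 ⟨by linarith [hf0 ω], by linarith [hf1 ω]⟩
  calc (f ω - m) * (f ω - 1 / 2) ≤ |f ω - m| * |f ω - 1 / 2| := by
        rw [← abs_mul]; exact le_abs_self _
    _ ≤ |f ω - m| * (1 / 2) := mul_le_mul_of_nonneg_left hhalf (abs_nonneg _)
    _ = |f ω - m| / 2 := by ring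

end Resampling

/-- OSSS inequality for monotonic measures.  Let `μ` be a fully supported
monotonic probability measure on `{0,1}^E` (`E` finite nonempty), `f : {0,1}^E → [0,1]`
nondecreasing, and `T` any decision tree (it picks an unrevealed coordinate as a function of
the revealed set and of the values revealed so far).  Then
`Var(f) ≤ ∑_e μ(e ∈ Ê) Cov(f, ω_e)`. -/
theorem osss_monotonic [Fintype E] [DecidableEq E] [Nonempty E]
    (μ : (E → Bool) → ℝ)
    (hpos : ∀ ω, 0 < μ ω) (hsum : ∑ ω : E → Bool, μ ω = 1)
    (hmono : ∀ (F : Finset E) (e : E), e ∉ F → ∀ ξ ξ' : E → Bool,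
      (∀ f ∈ F, ξ f ≤ ξ' f) →
      (∑ ω : E → Bool, if ω e = true ∧ ∀ f ∈ F, ω f = ξ f then μ ω else 0) /
          (∑ ω : E → Bool, if ∀ f ∈ F, ω f = ξ f then μ ω else 0) ≤
        (∑ ω : E → Bool, if ω e = true ∧ ∀ f ∈ F, ω f = ξ' f then μ ω else 0) /
          (∑ ω : E → Bool, if ∀ f ∈ F, ω f = ξ' f then μ ω else 0))
    (f : (E → Bool) → ℝ) (hf0 : ∀ ω, 0 ≤ f ω) (hf1 : ∀ ω, f ω ≤ 1)
    (hfmono : ∀ ω ω' : E → Bool, (∀ e, ω e ≤ ω' e) → f ω ≤ f ω')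
    (T : Finset E → (E → Bool) → E)
    (hT : ∀ F : Finset E, F ≠ Finset.univ → ∀ ξ, T F ξ ∉ F)
    (hTloc : ∀ (F : Finset E) (ξ ξ' : E → Bool), (∀ e ∈ F, ξ e = ξ' e) → T F ξ = T F ξ') :
    (∑ ω : E → Bool, μ ω * f ω ^ 2) - (∑ ω : E → Bool, μ ω * f ω) ^ 2 ≤
      ∑ e : E,
        (∑ ω : E → Bool, if e ∈ revealed T f ω then μ ω else 0) *
          ((∑ ω : E → Bool, μ ω * (f ω * if ω e then 1 else 0)) -
            (∑ ω : E → Bool, μ ω * f ω) *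
              (∑ ω : E → Bool, μ ω * if ω e then (1 : ℝ) else 0)) := by
  have hmono' : MonotonicWeight μ := by
    have hcoord : ∀ (F : Finset E) (e : E) (x : E → Bool), condExpect μ F x (coord e) =
        (∑ ω : E → Bool, if ω e = true ∧ ∀ f ∈ F, ω f = x f then μ ω else 0) /
          (∑ ω : E → Bool, if ∀ f ∈ F, ω f = x f then μ ω else 0) := by
      intro F e x
      simp only [condExpect, cylSum, coord, Pi.one_apply, mul_one, mul_ite, mul_zero,
        and_comm (a := _ = true), ite_and]
    intro F e he x y hxy
    rw [hcoord, hcoord]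
    exact hmono F e he x y hxy
  have hf : Monotone f := fun x y h => hfmono x y h
  have hL1 := sum_abs_sub_mean_le hpos hsum hmono' hf hT hTloc
  have hvar := variance_le_half_sum_abs hpos hsum hf0 hf1
  simp only [mul_assoc, ← Finset.mul_sum] at hL1
  exact hvar.trans (le_trans (b := ∑ e, coordCov μ f e * _) (by linarith)
    (Finset.sum_le_sum fun e _ => (mul_comm _ _).le))

end
end

section
/- Let d ≥ 1, let Λ ⊂ ℤ^d be a finite set, and let β ≥ 0. Let μ be the Ising measure on {−1,1}^Λ given by μ(σ) proportional to exp(β Σ σ_u σ_v), the sum being over unordered pairs {u,v} ⊆ Λ with ‖u−v‖₁ = 1. Write ⟨·⟩ for expectation under μ and C(x,y) = ⟨σ_x σ_y⟩. Then for all x₁, x₂, x₃, x₄ ∈ Λ, the fourth joint cumulant U₄(x₁,x₂,x₃,x₄) = ⟨σ_{x₁}σ_{x₂}σ_{x₃}σ_{x₄}⟩ − C(x₁,x₂)C(x₃,x₄) − C(x₁,x₃)C(x₂,x₄) − C(x₁,x₄)C(x₂,x₃) satisfies |U₄(x₁,x₂,x₃,x₄)| ≤ 2 Σ_{y ∈ Λ}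 C(x₁,y) C(x₂,y) C(x₃,y) C(x₄,y). -/
open scoped Classical

noncomputable section

/-- The spin value `±1` attached to a Boolean. -/
def spin (b : Bool) : ℝ := if b then 1 else -1

/-- The `ℓ¹`-distance on `ℤ^d`. -/
def dist1 {d : ℕ} (u v : Fin d → ℤ) : ℤ := ∑ i, |u i - v i|

/-- The Ising Boltzmann weight `exp(β ∑_{{u,v}⊆Λ, ‖u-v‖₁=1} σ_u σ_v)` of a configuration
`σ ∈ {-1,1}^Λ` (the sum over unordered pairs is written as half the sum over ordered
pairs). -/
def isingWeight {d : ℕ} (Λ : Finset (Fin d → ℤ)) (β : ℝ)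
    (σ : {x // x ∈ Λ} → Bool) : ℝ :=
  Real.exp (β * ((1 / 2) * ∑ u ∈ Λ.attach, ∑ v ∈ Λ.attach,
    if dist1 (u : Fin d → ℤ) (v : Fin d → ℤ) = 1 then spin (σ u) * spin (σ v) else 0))

/-- Expectation `⟨f⟩` under the finite-volume Ising measure on `{-1,1}^Λ` at inverse
temperature `β`. -/
def isingExp {d : ℕ} (Λ : Finset (Fin d → ℤ)) (β : ℝ)
    (f : ({x // x ∈ Λ} → Bool) → ℝ) : ℝ :=
  (∑ σ : {x // x ∈ Λ} → Bool, isingWeight Λ β σ * f σ) /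
    ∑ σ : {x // x ∈ Λ} → Bool, isingWeight Λ β σ

/-- The two-point function `C(x,y) = ⟨σ_x σ_y⟩`. -/
def twoPoint {d : ℕ} (Λ : Finset (Fin d → ℤ)) (β : ℝ) (x y : {x // x ∈ Λ}) : ℝ :=
  isingExp Λ β fun σ => spin (σ x) * spin (σ y)

section Positivity

set_option linter.unusedSectionVars false

variable {V : Type*} [Fintype V] [DecidableEq V]

theorem spin_mul_self (b : Bool) : spin b * spin b = 1 := by
  cases b <;> simp [spin]

theorem spin_beq (a b : Bool) : spin (a == b) = spin a * spin b := by
  cases a <;> cases b <;> simp [spin]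

theorem spin_not (b : Bool) : spin (!b) = -spin b := by
  cases b <;> simp [spin]

theorem spin_mul_spin_eq (a b : Bool) : spin a * spin b = 1 ∨ spin a * spin b = -1 := by
  cases a <;> cases b <;> simp [spin]

/-- Functions of the spins that are polynomials with nonnegative coefficients. -/
inductive SpinPositive : ((V → Bool) → ℝ) → Prop
  | monomial (c : ℝ) (hc : 0 ≤ c) (n : V → ℕ) :
      SpinPositive fun σ => c * ∏ v, spin (σ v) ^ n v
  | add {f g : (V → Bool) → ℝ} (hf : SpinPositive f) (hg : SpinPositive g) :
      SpinPositive fun σ => f σ + g σ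

namespace SpinPositive

theorem const {c : ℝ} (hc : 0 ≤ c) : SpinPositive fun _ : V → Bool => c := by
  simpa using monomial c hc fun _ : V => 0

theorem spin_apply (x : V) : SpinPositive fun σ : V → Bool => spin (σ x) := by
  have h := monomial 1 zero_le_one (Pi.single x 1 : V → ℕ)
  have e : (fun σ : V → Bool => spin (σ x)) =
      fun σ => 1 * ∏ v, spin (σ v) ^ (Pi.single x 1 : V → ℕ) v := by
    funext σ
    rw [one_mul, Finset.prod_eq_single x]
    · simp
    · intro b _ hb
      simp [Pi.single_eq_of_ne hb]
    · simp
  rwa [e]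

theorem mul {f g : (V → Bool) → ℝ} (hf : SpinPositive f) (hg : SpinPositive g) :
    SpinPositive fun σ => f σ * g σ := by
  induction hf with
  | monomial c hc n =>
    induction hg with
    | monomial c' hc' n' =>
      have h := monomial (c * c') (mul_nonneg hc hc') (n + n')
      simpa only [Pi.add_apply, pow_add, Finset.prod_mul_distrib, mul_mul_mul_comm] using h
    | add _ _ ih₁ ih₂ => simpa only [mul_add] using ih₁.add ih₂
  | add _ _ ih₁ ih₂ => simpa only [add_mul] using ih₁.add ih₂

theorem sum {ι : Type*} (s : Finset ι) {f : ι → (V → Bool) → ℝ}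
    (hf : ∀ i ∈ s, SpinPositive (f i)) : SpinPositive fun σ => ∑ i ∈ s, f i σ := by
  induction s using Finset.induction_on with
  | empty => simpa using const (V := V) le_rfl
  | insert i s hi ih =>
    simp only [Finset.sum_insert hi]
    exact (hf i (by simp)).add (ih fun j hj => hf j (by simp [hj]))

theorem prod {ι : Type*} (s : Finset ι) {f : ι → (V → Bool) → ℝ}
    (hf : ∀ i ∈ s, SpinPositive (f i)) : SpinPositive fun σ => ∏ i ∈ s, f i σ := by
  induction s using Finset.induction_on with
  | empty => simpa using const (V := V) zero_le_one
  | insert i s hi ih =>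
    simp only [Finset.prod_insert hi]
    exact (hf i (by simp)).mul (ih fun j hj => hf j (by simp [hj]))

theorem sum_nonneg {f : (V → Bool) → ℝ} (hf : SpinPositive f) : 0 ≤ ∑ σ, f σ := by
  induction hf with
  | monomial c hc n =>
    rw [← Finset.mul_sum]
    refine mul_nonneg hc ?_
    have h := Finset.prod_univ_sum (fun _ : V => (Finset.univ : Finset Bool))
      fun v b => spin b ^ n v
    rw [Fintype.piFinset_univ] at h
    rw [← h]
    refine Finset.prod_nonneg fun v _ => ?_
    rcases Nat.even_or_odd (n v) with h | h <;> simp [spin, h.neg_one_pow]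
  | add _ _ ih₁ ih₂ =>
    rw [Finset.sum_add_distrib]
    exact add_nonneg ih₁ ih₂

theorem exp_sub_one {t : ℝ} (ht : 0 ≤ t) (x y : V) :
    SpinPositive fun σ : V → Bool => Real.exp (t * (spin (σ x) * spin (σ y))) - 1 := by
  have e : (fun σ : V → Bool => Real.exp (t * (spin (σ x) * spin (σ y))) - 1) =
      fun σ => (Real.cosh t - 1) + Real.sinh t * (spin (σ x) * spin (σ y)) := by
    funext σ
    rcases spin_mul_spin_eq (σ x) (σ y) with h | h <;> rw [h]
    · rw [mul_one, mul_one, ← Real.cosh_add_sinh]; ring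
    · rw [mul_neg_one, mul_neg_one, ← Real.cosh_sub_sinh]; ring
  rw [e]
  exact (const (sub_nonneg.2 (Real.one_le_cosh t))).add
    ((const (Real.sinh_nonneg_iff.2 ht)).mul ((spin_apply x).mul (spin_apply y)))

theorem exp_spin {t : ℝ} (ht : 0 ≤ t) (x y : V) :
    SpinPositive fun σ : V → Bool => Real.exp (t * (spin (σ x) * spin (σ y))) := by
  simpa using (exp_sub_one ht x y).add (const zero_le_one)

end SpinPositive

/-- The Boltzmann weight with pair couplings `a`, summed over ordered pairs. -/
def pairWeight (a : V → V → ℝ) (σ : V → Bool) : ℝ :=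
  Real.exp (∑ u, ∑ v, a u v * (spin (σ u) * spin (σ v)))

theorem pairWeight_pos (a : V → V → ℝ) (σ : V → Bool) : 0 < pairWeight a σ := Real.exp_pos _

theorem pairWeight_add (a b : V → V → ℝ) (σ : V → Bool) :
    pairWeight (a + b) σ = pairWeight a σ * pairWeight b σ := by
  simp only [pairWeight, ← Real.exp_add, ← Finset.sum_add_distrib, Pi.add_apply, add_mul]

theorem SpinPositive.pairWeight {a : V → V → ℝ} (ha : 0 ≤ a) :
    SpinPositive (pairWeight a) := by
  have e : _root_.pairWeight a =
      fun σ => ∏ u, ∏ v, Real.exp (a u v * (spin (σ u) * spin (σ v))) := by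
    funext σ
    simp only [_root_.pairWeight, Real.exp_sum]
  rw [e]
  exact .prod _ fun u _ => .prod _ fun v _ => .exp_spin (ha u v) u v

theorem SpinPositive.pairWeight_sub_one {a : V → V → ℝ} (ha : 0 ≤ a) :
    SpinPositive fun σ => _root_.pairWeight a σ - 1 := by
  have key : ∀ s : Finset (V × V), SpinPositive fun σ : V → Bool =>
      ∏ e ∈ s, Real.exp (a e.1 e.2 * (spin (σ e.1) * spin (σ e.2))) - 1 := by
    intro s
    induction s using Finset.induction_on with
    | empty => simpa using SpinPositive.const (V := V) le_rfl
    | insert e s he ih =>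
      have h := ((SpinPositive.exp_spin (ha e.1 e.2) e.1 e.2).mul ih).add
        (SpinPositive.exp_sub_one (ha e.1 e.2) e.1 e.2)
      simp only [Finset.prod_insert he]
      convert h using 2
      ring
  have e : (fun σ => _root_.pairWeight a σ - 1) = fun σ : V → Bool =>
      ∏ e : V × V, Real.exp (a e.1 e.2 * (spin (σ e.1) * spin (σ e.2))) - 1 := by
    funext σ
    simp only [_root_.pairWeight, ← Real.exp_sum, Fintype.sum_prod_type]
  rw [e]
  exact key _

/-- Summing over a second configuration is the same as summing over the relative sign. -/
theorem sum_relative_sign (f : (V → Bool) → (V → Bool) → ℝ) :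
    ∑ σ, ∑ τ : V → Bool, f σ (fun v => σ v == τ v) = ∑ σ, ∑ σ', f σ σ' := by
  refine Finset.sum_congr rfl fun σ _ => ?_
  have hinv : Function.Involutive fun τ : V → Bool => fun v => σ v == τ v := by
    intro τ
    funext v
    cases h₁ : σ v <;> cases h₂ : τ v <;> simp [h₁, h₂]
  exact Fintype.sum_equiv hinv.toPerm _ _ fun τ => rfl

theorem pairWeight_mul_relative (a : V → V → ℝ) (σ τ : V → Bool) :
    pairWeight (fun u v => a u v * (1 + spin (τ u) * spin (τ v))) σ =
      pairWeight a σ * pairWeight a fun v => σ v == τ v := by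
  simp only [pairWeight, ← Real.exp_add, ← Finset.sum_add_distrib, spin_beq]
  congr 1
  refine Finset.sum_congr rfl fun u _ => Finset.sum_congr rfl fun v _ => ?_
  ring

theorem one_add_spin_mul_spin_nonneg (a b : Bool) : 0 ≤ 1 + spin a * spin b := by
  rcases spin_mul_spin_eq a b with h | h <;> rw [h] <;> norm_num

theorem sum_mul_pairWeight_mul_sum (a : V → V → ℝ) (F G : (V → Bool) → ℝ) :
    (∑ σ, F σ * pairWeight a σ) * (∑ σ, G σ * pairWeight a σ) =
      ∑ σ, ∑ τ : V → Bool, F σ * G (fun v => σ v == τ v) *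
        pairWeight (fun u v => a u v * (1 + spin (τ u) * spin (τ v))) σ := by
  simp only [pairWeight_mul_relative]
  rw [sum_relative_sign fun σ σ' => F σ * G σ' * (pairWeight a σ * pairWeight a σ'),
    Finset.sum_mul_sum]
  exact Finset.sum_congr rfl fun σ _ => Finset.sum_congr rfl fun σ' _ => by ring

/-- Griffiths' second inequality. -/
theorem griffiths_second {a : V → V → ℝ} (ha : 0 ≤ a) {F G : (V → Bool) → ℝ}
    (hF : SpinPositive F) (hG : SpinPositive G) :
    (∑ σ, F σ * pairWeight a σ) * (∑ σ, G σ * pairWeight a σ) ≤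
      (∑ σ, F σ * G σ * pairWeight a σ) * ∑ σ, pairWeight a σ := by
  induction hG with
  | add _ _ ih₁ ih₂ =>
    simp only [mul_add, add_mul, Finset.sum_add_distrib]
    exact add_le_add ih₁ ih₂
  | monomial c hc n =>
    have e : ∑ σ, pairWeight a σ = ∑ σ, 1 * pairWeight a σ := by simp only [one_mul]
    rw [e, sum_mul_pairWeight_mul_sum, sum_mul_pairWeight_mul_sum _ _ fun _ => (1 : ℝ),
      ← sub_nonneg, ← Finset.sum_sub_distrib]
    simp only [← Finset.sum_sub_distrib]
    rw [Finset.sum_comm]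
    refine Finset.sum_nonneg fun τ _ => ?_
    have hτ : (0 : ℝ) ≤ 1 - ∏ v, spin (τ v) ^ n v := by
      refine sub_nonneg.2 (le_of_abs_le ?_)
      rw [Finset.abs_prod]
      refine (Finset.prod_eq_one fun v _ => ?_).le
      cases τ v <;> simp [spin]
    have hW : SpinPositive
        (pairWeight fun u v => a u v * (1 + spin (τ u) * spin (τ v))) :=
      .pairWeight fun u v => mul_nonneg (ha u v) (one_add_spin_mul_spin_nonneg _ _)
    have h := (((SpinPositive.const hτ).mul hF).mul (.monomial c hc n)).mul hW
    refine h.sum_nonneg.trans_eq (Finset.sum_congr rfl fun σ _ => ?_)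
    simp only [spin_beq, mul_pow, Finset.prod_mul_distrib]
    ring

end Positivity

section Cluster

set_option linter.unusedSectionVars false

variable {V : Type*} [Fintype V] [DecidableEq V]

/-- The set of vertices connected to `o` by the edges in `ω`, orientations being ignored. -/
def edgeCluster (o : V) (ω : Finset (V × V)) : Finset V :=
  {v | Relation.ReflTransGen (fun u v => (u, v) ∈ ω ∨ (v, u) ∈ ω) o v}

/-- The total weight of the edge sets on `S` that connect every vertex of `S` to `o`. -/
def clusterWeight (a : V → V → ℝ) (o : V) (S : Finset V) : ℝ :=
  ∑ ω ∈ (S ×ˢ S).powerset with edgeCluster o ω = S, ∏ e ∈ ω, a e.1 e.2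

theorem mem_edgeCluster_self (o : V) (ω : Finset (V × V)) : o ∈ edgeCluster o ω := by
  simp [edgeCluster, Relation.ReflTransGen.refl]

theorem mem_edgeCluster_iff {o : V} {ω : Finset (V × V)} {e : V × V} (he : e ∈ ω) :
    e.1 ∈ edgeCluster o ω ↔ e.2 ∈ edgeCluster o ω := by
  simp only [edgeCluster, Finset.mem_filter, Finset.mem_univ, true_and]
  exact ⟨fun h => h.tail (.inl he), fun h => h.tail (.inr he)⟩

/-- A vertex property preserved along the edges of `ω` holds on the whole cluster. -/
theorem edgeCluster_induction {o : V} {ω : Finset (V × V)} {p : V → Prop} (ho : p o)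
    (h : ∀ e ∈ ω, p e.1 ↔ p e.2) {v : V} (hv : v ∈ edgeCluster o ω) : p v := by
  simp only [edgeCluster, Finset.mem_filter, Finset.mem_univ, true_and] at hv
  induction hv with
  | refl => exact ho
  | tail _ hbc ih =>
    rcases hbc with hbc | hbc
    · exact (h _ hbc).1 ih
    · exact (h _ hbc).2 ih

theorem edgeCluster_mono {o : V} {ω ω' : Finset (V × V)} (h : ω ⊆ ω') :
    edgeCluster o ω ⊆ edgeCluster o ω' := fun _ hv =>
  edgeCluster_induction (mem_edgeCluster_self o ω')
    (fun _ he => mem_edgeCluster_iff (h he)) hv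

theorem edgeCluster_subset {o : V} {ω : Finset (V × V)} {A : Finset V} (ho : o ∈ A)
    (hω : ω ⊆ A ×ˢ A) : edgeCluster o ω ⊆ A := fun _ hv =>
  edgeCluster_induction (p := (· ∈ A)) ho
    (fun _ he => by have := Finset.mem_product.1 (hω he); tauto) hv

theorem edgeCluster_union {o : V} {S : Finset V} {ω₁ ω₂ : Finset (V × V)}
    (h₁ : edgeCluster o ω₁ = S) (h₂ : ∀ e ∈ ω₂, e.1 ∉ S ∧ e.2 ∉ S) :
    edgeCluster o (ω₁ ∪ ω₂) = S := by
  refine Finset.Subset.antisymm (fun v hv => ?_)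
    (h₁ ▸ edgeCluster_mono Finset.subset_union_left)
  refine edgeCluster_induction (p := (· ∈ S)) (h₁ ▸ mem_edgeCluster_self o ω₁) ?_ hv
  intro e he
  rcases Finset.mem_union.1 he with he | he
  · exact h₁ ▸ mem_edgeCluster_iff he
  · have := h₂ e he
    tauto

theorem edgeCluster_inter {o : V} {S : Finset V} {ω : Finset (V × V)}
    (h : edgeCluster o ω = S) : edgeCluster o (ω ∩ S ×ˢ S) = S := by
  have hmem : ∀ e ∈ ω, (e.1 ∈ S ↔ e.2 ∈ S) := fun e he => h ▸ mem_edgeCluster_iff he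
  have hoS : o ∈ S := h ▸ mem_edgeCluster_self o ω
  refine Finset.Subset.antisymm (edgeCluster_subset hoS Finset.inter_subset_right)
    fun v hv => ?_
  rw [← h] at hv
  refine (edgeCluster_induction (p := fun v => v ∈ S ∧ v ∈ edgeCluster o (ω ∩ S ×ˢ S))
    ⟨hoS, mem_edgeCluster_self _ _⟩ (fun e he => ?_) hv).2
  by_cases hS : e.1 ∈ S
  · have he' : e ∈ ω ∩ S ×ˢ S := by
      simp [he, hS, (hmem e he).1 hS]
    have := hmem e he
    have := mem_edgeCluster_iff (o := o) he'
    tauto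
  · have := hmem e he
    tauto

/-- Expansion of a product over pairs according to the cluster of `o`. -/
theorem prod_one_add_eq_sum_clusterWeight (a : V → V → ℝ) {o : V} {A : Finset V}
    (ho : o ∈ A) :
    ∏ e ∈ A ×ˢ A, (1 + a e.1 e.2) =
      ∑ S ∈ A.powerset with o ∈ S,
        clusterWeight a o S * ∏ e ∈ (A \ S) ×ˢ (A \ S), (1 + a e.1 e.2) := by
  rw [Finset.prod_one_add, ← Finset.sum_fiberwise_of_maps_to
    (t := {S ∈ A.powerset | o ∈ S}) (g := edgeCluster o)]
  · refine Finset.sum_congr rfl fun S hS => ?_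
    obtain ⟨hSA, hoS⟩ := Finset.mem_filter.1 hS
    rw [Finset.mem_powerset] at hSA
    rw [clusterWeight, Finset.prod_one_add, Finset.sum_mul_sum, ← Finset.sum_product']
    have hsplit : ∀ ω ⊆ A ×ˢ A, edgeCluster o ω = S →
        ω ∩ S ×ˢ S ∪ ω ∩ (A \ S) ×ˢ (A \ S) = ω := by
      intro ω hω h
      ext e
      have hmem : e ∈ ω → (e.1 ∈ S ↔ e.2 ∈ S) := fun he => h ▸ mem_edgeCluster_iff he
      have hA : e ∈ ω → e.1 ∈ A ∧ e.2 ∈ A := fun he => Finset.mem_product.1 (hω he)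
      simp only [Finset.mem_union, Finset.mem_inter, Finset.mem_product, Finset.mem_sdiff]
      tauto
    have hdisj : Disjoint (S ×ˢ S) ((A \ S) ×ˢ (A \ S)) := by
      rw [Finset.disjoint_left]
      intro e
      simp only [Finset.mem_product, Finset.mem_sdiff]
      tauto
    refine Finset.sum_bij'
      (fun ω _ => (ω ∩ S ×ˢ S, ω ∩ (A \ S) ×ˢ (A \ S))) (fun p _ => p.1 ∪ p.2) ?_ ?_ ?_ ?_ ?_
    · intro ω hω
      obtain ⟨hω, h⟩ := Finset.mem_filter.1 hω
      simp [edgeCluster_inter h, Finset.inter_subset_right]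
    · rintro ⟨ω₁, ω₂⟩ h
      simp only [Finset.mem_product, Finset.mem_filter, Finset.mem_powerset] at h ⊢
      obtain ⟨⟨h₁, hc⟩, h₂⟩ := h
      refine ⟨Finset.union_subset (h₁.trans (Finset.product_subset_product hSA hSA))
        (h₂.trans (Finset.product_subset_product Finset.sdiff_subset Finset.sdiff_subset)),
        edgeCluster_union hc fun e he => ?_⟩
      have := h₂ he
      simp only [Finset.mem_product, Finset.mem_sdiff] at this
      tauto
    · intro ω hω
      obtain ⟨hω, h⟩ := Finset.mem_filter.1 hω
      exact hsplit ω (Finset.mem_powerset.1 hω) h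
    · rintro ⟨ω₁, ω₂⟩ h
      simp only [Finset.mem_product, Finset.mem_filter, Finset.mem_powerset] at h
      obtain ⟨⟨h₁, -⟩, h₂⟩ := h
      rw [Finset.disjoint_left] at hdisj
      ext e
      · have := @h₁ e
        have := @h₂ e
        have := @hdisj e
        simp only [Finset.mem_union, Finset.mem_inter]
        tauto
      · have := @h₁ e
        have := @h₂ e
        have := @hdisj e
        simp only [Finset.mem_union, Finset.mem_inter]
        tauto
    · intro ω hω
      obtain ⟨hω, h⟩ := Finset.mem_filter.1 hω
      rw [← Finset.prod_union (hdisj.mono Finset.inter_subset_right Finset.inter_subset_right),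
        hsplit ω (Finset.mem_powerset.1 hω) h]
  · intro ω hω
    rw [Finset.mem_powerset] at hω
    simp [edgeCluster_subset ho hω, mem_edgeCluster_self]

theorem clusterWeight_congr {a b : V → V → ℝ} {S : Finset V}
    (h : ∀ u ∈ S, ∀ v ∈ S, a u v = b u v) (o : V) :
    clusterWeight a o S = clusterWeight b o S := by
  refine Finset.sum_congr rfl fun ω hω => Finset.prod_congr rfl fun e he => ?_
  have := Finset.mem_product.1 (Finset.mem_powerset.1 (Finset.mem_filter.1 hω).1 he)
  exact h _ this.1 _ this.2

/-- If `a` only charges pairs on which `f` agrees, a nonzero cluster weight forces `f` to be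
constant on the cluster. -/
theorem eq_of_clusterWeight_ne_zero {α : Type*} {a : V → V → ℝ} {f : V → α} {o : V}
    {S : Finset V} (ha : ∀ u v, f u ≠ f v → a u v = 0) (h : clusterWeight a o S ≠ 0)
    {v : V} (hv : v ∈ S) : f v = f o := by
  obtain ⟨ω, hω, hne⟩ := Finset.exists_ne_zero_of_sum_ne_zero h
  obtain ⟨-, hS⟩ := Finset.mem_filter.1 hω
  rw [← hS] at hv
  refine edgeCluster_induction (p := fun v => f v = f o) rfl (fun e he => ?_) hv
  have : f e.1 = f e.2 := by
    by_contra hf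
    exact hne (Finset.prod_eq_zero he (ha _ _ hf))
  rw [this]

end Cluster

section Replica

set_option linter.unusedSectionVars false

variable {V : Type*} [Fintype V] [DecidableEq V]

/-- The couplings `J` with all pairs not contained in `A` removed. -/
def restrictCoupling (J : V → V → ℝ) (A : Finset V) : V → V → ℝ :=
  fun u v => if u ∈ A ∧ v ∈ A then J u v else 0

theorem restrictCoupling_nonneg {J : V → V → ℝ} (hJ : 0 ≤ J) (A : Finset V) :
    0 ≤ restrictCoupling J A := by
  intro u v
  rw [restrictCoupling]
  split_ifs
  exacts [hJ u v, le_rfl]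

/-- The unnormalised expectation of `F` for the couplings `J` restricted to `A`. -/
def isingSum (J : V → V → ℝ) (A : Finset V) (F : (V → Bool) → ℝ) : ℝ :=
  ∑ σ, F σ * pairWeight (restrictCoupling J A) σ

/-- The partition function of the couplings `J` restricted to `A`. -/
def partitionSum (J : V → V → ℝ) (A : Finset V) : ℝ := isingSum J A fun _ => 1

/-- The unnormalised two-point function. -/
def pairSum (J : V → V → ℝ) (A : Finset V) (x y : V) : ℝ :=
  isingSum J A fun σ => spin (σ x) * spin (σ y)

/-- The two-point function of the model on `A`, set to zero off `A`. -/
def correlation (J : V → V → ℝ) (A : Finset V) (x y : V) : ℝ :=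
  if x ∈ A ∧ y ∈ A then pairSum J A x y / partitionSum J A else 0

theorem partitionSum_pos (J : V → V → ℝ) (A : Finset V) : 0 < partitionSum J A :=
  Finset.sum_pos (fun σ _ => by simpa using pairWeight_pos _ σ) Finset.univ_nonempty

/-- The joint weight of a configuration `σ` and the relative sign `τ` between `σ` and an
independent copy of it. -/
def replicaWeight (J : V → V → ℝ) (A : Finset V) (p : (V → Bool) × (V → Bool)) : ℝ :=
  pairWeight (fun u v => restrictCoupling J A u v * (1 + spin (p.2 u) * spin (p.2 v))) p.1

/-- The expansion parameter of the replica weight on a pair. -/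
def replicaEdge (J : V → V → ℝ) (p : (V → Bool) × (V → Bool)) (u v : V) : ℝ :=
  Real.exp (J u v * (1 + spin (p.2 u) * spin (p.2 v)) * (spin (p.1 u) * spin (p.1 v))) - 1

/-- The part of the replica weight carried by a cluster `S` rooted at `o`. -/
def replicaCluster (J : V → V → ℝ) (o : V) (S : Finset V) (p : (V → Bool) × (V → Bool)) : ℝ :=
  clusterWeight (replicaEdge J p) o S

theorem isingSum_mul_isingSum (J : V → V → ℝ) (A : Finset V) (F G : (V → Bool) → ℝ) :
    isingSum J A F * isingSum J A G =
      ∑ p : (V → Bool) × (V → Bool),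
        F p.1 * G (fun v => p.1 v == p.2 v) * replicaWeight J A p := by
  rw [Fintype.sum_prod_type]
  exact sum_mul_pairWeight_mul_sum _ F G

theorem replicaWeight_eq_prod (J : V → V → ℝ) (A : Finset V) (p : (V → Bool) × (V → Bool)) :
    replicaWeight J A p = ∏ e ∈ A ×ˢ A, (1 + replicaEdge J p e.1 e.2) := by
  simp only [replicaWeight, pairWeight, replicaEdge, add_sub_cancel, ← Real.exp_sum]
  rw [← Fintype.sum_prod_type' (f := fun u v => restrictCoupling J A u v *
    (1 + spin (p.2 u) * spin (p.2 v)) * (spin (p.1 u) * spin (p.1 v)))]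
  congr 1
  symm
  refine Finset.sum_subset_zero_on_sdiff (Finset.subset_univ _) (fun e he => ?_)
    fun e he => ?_
  · have : ¬(e.1 ∈ A ∧ e.2 ∈ A) := by simpa using he
    simp [restrictCoupling, this]
  · simp [restrictCoupling, Finset.mem_product.1 he]

theorem sum_mul_replicaWeight (J : V → V → ℝ) {A : Finset V} {o : V} (ho : o ∈ A)
    (X : (V → Bool) × (V → Bool) → ℝ) :
    ∑ p, X p * replicaWeight J A p =
      ∑ S ∈ A.powerset with o ∈ S,
        ∑ p, X p * (replicaCluster J o S p * replicaWeight J (A \ S) p) := by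
  rw [Finset.sum_comm]
  refine Finset.sum_congr rfl fun p _ => ?_
  rw [replicaWeight_eq_prod, prod_one_add_eq_sum_clusterWeight _ ho, Finset.mul_sum]
  refine Finset.sum_congr rfl fun S _ => ?_
  rw [replicaCluster, replicaWeight_eq_prod]

theorem SpinPositive.replicaCluster {J : V → V → ℝ} (hJ : 0 ≤ J) (o : V) (S : Finset V)
    (τ : V → Bool) : SpinPositive fun σ => replicaCluster J o S (σ, τ) :=
  .sum _ fun _ _ => .prod _ fun e _ =>
    .exp_sub_one (mul_nonneg (hJ _ _) (one_add_spin_mul_spin_nonneg _ _)) e.1 e.2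

theorem SpinPositive.replicaWeight {J : V → V → ℝ} (hJ : 0 ≤ J) (A : Finset V)
    (τ : V → Bool) : SpinPositive fun σ => replicaWeight J A (σ, τ) :=
  .pairWeight fun u v =>
    mul_nonneg (restrictCoupling_nonneg hJ A u v) (one_add_spin_mul_spin_nonneg _ _)

/-- On a cluster the relative sign is constant. -/
theorem replicaCluster_mul_spin {J : V → V → ℝ} {o v : V} {S : Finset V} (hv : v ∈ S)
    (p : (V → Bool) × (V → Bool)) :
    replicaCluster J o S p * (spin (p.2 o) * spin (p.2 v)) = replicaCluster J o S p := by
  by_cases h : replicaCluster J o S p = 0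
  · simp [h]
  · have : p.2 v = p.2 o := by
      refine eq_of_clusterWeight_ne_zero (a := replicaEdge J p) (fun u w huw => ?_) h hv
      have : spin (p.2 u) * spin (p.2 w) = -1 := by
        revert huw
        cases p.2 u <;> cases p.2 w <;> simp [spin]
      simp [replicaEdge, this]
    rw [this, spin_mul_self, mul_one]

/-- `f` depends only on the values of the two configurations on `S`. -/
def SupportedOn (S : Set V) (f : (V → Bool) × (V → Bool) → ℝ) : Prop :=
  ∀ p q : (V → Bool) × (V → Bool), (∀ v ∈ S, p.1 v = q.1 v ∧ p.2 v = q.2 v) → f p = f q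

theorem replicaCluster_supportedOn (J : V → V → ℝ) (o : V) (S : Finset V) :
    SupportedOn S (replicaCluster J o S) := by
  intro p q h
  refine clusterWeight_congr (fun u hu v hv => ?_) o
  have h₁ := h u hu
  have h₂ := h v hv
  simp only [replicaEdge, h₁, h₂]

theorem replicaWeight_supportedOn (J : V → V → ℝ) (A : Finset V) :
    SupportedOn A (replicaWeight J A) := by
  intro p q h
  simp only [replicaWeight_eq_prod]
  refine Finset.prod_congr rfl fun e he => ?_
  have h₁ := h e.1 (Finset.mem_product.1 he).1
  have h₂ := h e.2 (Finset.mem_product.1 he).2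
  simp only [replicaEdge, h₁, h₂]

theorem sum_mul_sum_of_supportedOn {S : Finset V} {f g : (V → Bool) × (V → Bool) → ℝ}
    (hf : SupportedOn S f) (hg : SupportedOn (S : Set V)ᶜ g) :
    (∑ p, f p) * ∑ p, g p =
      (Fintype.card ((V → Bool) × (V → Bool)) : ℝ) * ∑ p, f p * g p := by
  let mix : (V → Bool) × (V → Bool) → (V → Bool) × (V → Bool) → (V → Bool) × (V → Bool) :=
    fun p q => (S.piecewise p.1 q.1, S.piecewise p.2 q.2)
  have hinv : Function.Involutive fun r : ((V → Bool) × (V → Bool)) × ((V → Bool) × (V → Bool)) =>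
      (mix r.1 r.2, mix r.2 r.1) := by
    rintro ⟨⟨p₁, p₂⟩, ⟨q₁, q₂⟩⟩
    simp only [mix, Prod.mk.injEq]
    refine ⟨⟨?_, ?_⟩, ⟨?_, ?_⟩⟩ <;> funext v <;> by_cases hv : v ∈ S <;> simp [hv]
  rw [Finset.sum_mul_sum, ← Fintype.sum_prod_type' (f := fun p q => f p * g q),
    Fintype.sum_equiv hinv.toPerm _ (fun r => f r.1 * g r.1), Fintype.sum_prod_type_right]
  · simp
  · rintro ⟨p, q⟩
    change f p * g q = f (mix p q) * g (mix p q)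
    congr 1
    · exact hf _ _ fun v hv => by simp [mix, Finset.mem_coe.1 hv]
    · exact hg _ _ fun v hv => by
        have : v ∉ S := hv
        simp [mix, this]

/-- Reverse the spins on `S`. -/
def flipOn (S : Finset V) (σ : V → Bool) : V → Bool := fun v => if v ∈ S then !σ v else σ v

theorem flipOn_involutive (S : Finset V) : Function.Involutive (flipOn S) := by
  intro σ
  funext v
  by_cases hv : v ∈ S <;> simp [flipOn, hv]

theorem spin_flipOn_of_mem {S : Finset V} {v : V} (hv : v ∈ S) (σ : V → Bool) :
    spin (flipOn S σ v) = -spin (σ v) := by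
  simp [flipOn, hv, spin_not]

theorem spin_flipOn_of_notMem {S : Finset V} {v : V} (hv : v ∉ S) (σ : V → Bool) :
    spin (flipOn S σ v) = spin (σ v) := by
  simp [flipOn, hv]

theorem spin_flipOn_mul {S : Finset V} {u v : V} (h : u ∈ S ↔ v ∈ S) (σ : V → Bool) :
    spin (flipOn S σ u) * spin (flipOn S σ v) = spin (σ u) * spin (σ v) := by
  by_cases hu : u ∈ S
  · rw [spin_flipOn_of_mem hu, spin_flipOn_of_mem (h.1 hu), neg_mul_neg]
  · rw [spin_flipOn_of_notMem hu, spin_flipOn_of_notMem (mt h.2 hu)]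

theorem sum_eq_zero_of_flip_fst (S : Finset V) {f : (V → Bool) × (V → Bool) → ℝ}
    (h : ∀ p, f (flipOn S p.1, p.2) = -f p) : ∑ p, f p = 0 := by
  have hs := Fintype.sum_equiv ((flipOn_involutive S).toPerm.prodCongr (Equiv.refl (V → Bool)))
    (fun p => f (flipOn S p.1, p.2)) f fun _ => rfl
  simp only [h, Finset.sum_neg_distrib] at hs
  linarith

theorem sum_eq_zero_of_flip_snd (S : Finset V) {f : (V → Bool) × (V → Bool) → ℝ}
    (h : ∀ p, f (p.1, flipOn S p.2) = -f p) : ∑ p, f p = 0 := by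
  have hs := Fintype.sum_equiv ((Equiv.refl (V → Bool)).prodCongr (flipOn_involutive S).toPerm)
    (fun p => f (p.1, flipOn S p.2)) f fun _ => rfl
  simp only [h, Finset.sum_neg_distrib] at hs
  linarith

section Flip

variable (J : V → V → ℝ) (o : V) {A S : Finset V}

theorem replicaCluster_flip_fst (p : (V → Bool) × (V → Bool)) :
    replicaCluster J o S (flipOn S p.1, p.2) = replicaCluster J o S p :=
  clusterWeight_congr (fun u hu v hv => by
    simp only [replicaEdge, spin_flipOn_mul (iff_of_true hu hv)]) o

theorem replicaWeight_flip_fst (p : (V → Bool) × (V → Bool)) :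
    replicaWeight J (A \ S) (flipOn S p.1, p.2) = replicaWeight J (A \ S) p :=
  replicaWeight_supportedOn J (A \ S) _ _ fun v hv => by
    have : v ∉ S := (Finset.mem_sdiff.1 hv).2
    simp [flipOn, this]

theorem replicaCluster_flip_snd (p : (V → Bool) × (V → Bool)) :
    replicaCluster J o S (p.1, flipOn Sᶜ p.2) = replicaCluster J o S p :=
  replicaCluster_supportedOn J o S _ _ fun v hv => by
    have : v ∈ S := hv
    simp [flipOn, this]

theorem replicaWeight_flip_snd (p : (V → Bool) × (V → Bool)) :
    replicaWeight J (A \ S) (p.1, flipOn Sᶜ p.2) = replicaWeight J (A \ S) p := by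
  simp only [replicaWeight_eq_prod]
  refine Finset.prod_congr rfl fun e he => ?_
  simp only [Finset.mem_product, Finset.mem_sdiff] at he
  have : e.1 ∈ Sᶜ ↔ e.2 ∈ Sᶜ := by simp [he]
  simp only [replicaEdge, spin_flipOn_mul this]

end Flip

/-- The contribution of the cluster `S` of `o` to the two-point function of `o` and `x`. -/
def clusterPairSum (J : V → V → ℝ) (A : Finset V) (o x : V) (S : Finset V) : ℝ :=
  ∑ p : (V → Bool) × (V → Bool), spin (p.1 o) * spin (p.1 x) *
    (replicaCluster J o S p * replicaWeight J (A \ S) p)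

theorem partitionSum_mul_pairSum (J : V → V → ℝ) {A : Finset V} {o : V} (ho : o ∈ A) (x : V) :
    pairSum J A o x * partitionSum J A =
      ∑ S ∈ A.powerset with o ∈ S, clusterPairSum J A o x S := by
  rw [pairSum, partitionSum, isingSum_mul_isingSum]
  simp only [mul_one]
  rw [sum_mul_replicaWeight J ho]
  rfl

theorem pairSum_mul_pairSum (J : V → V → ℝ) {A : Finset V} {o : V} (ho : o ∈ A) (x y : V) :
    pairSum J A o y * pairSum J A x y =
      ∑ S ∈ A.powerset with o ∈ S, if y ∈ S then clusterPairSum J A o x S else 0 := by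
  rw [mul_comm, pairSum, pairSum, isingSum_mul_isingSum, sum_mul_replicaWeight J ho]
  refine Finset.sum_congr rfl fun S hS => ?_
  have e : ∀ p : (V → Bool) × (V → Bool),
      spin (p.1 x) * spin (p.1 y) * (spin (p.1 o == p.2 o) * spin (p.1 y == p.2 y)) =
        spin (p.1 o) * spin (p.1 x) * (spin (p.2 o) * spin (p.2 y)) := by
    intro p
    simp only [spin_beq]
    linear_combination (spin (p.1 o) * spin (p.1 x) * spin (p.2 o) * spin (p.2 y)) *
      spin_mul_self (p.1 y)
  simp only [e]
  split_ifs with hy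
  · refine Finset.sum_congr rfl fun p _ => ?_
    linear_combination (spin (p.1 o) * spin (p.1 x) * replicaWeight J (A \ S) p) *
      replicaCluster_mul_spin (J := J) (o := o) hy p
  · refine sum_eq_zero_of_flip_snd Sᶜ fun p => ?_
    rw [replicaCluster_flip_snd, replicaWeight_flip_snd]
    simp only []
    rw [spin_flipOn_of_mem (Finset.mem_compl.2 hy),
      spin_flipOn_of_notMem (by simpa using (Finset.mem_filter.1 hS).2)]
    ring

theorem clusterPairSum_nonneg {J : V → V → ℝ} (hJ : 0 ≤ J) (A : Finset V) (o x : V)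
    (S : Finset V) : 0 ≤ clusterPairSum J A o x S := by
  rw [clusterPairSum, Fintype.sum_prod_type_right]
  exact Finset.sum_nonneg fun τ _ => (((SpinPositive.spin_apply o).mul (.spin_apply x)).mul
    ((SpinPositive.replicaCluster hJ o S τ).mul (.replicaWeight hJ _ τ))).sum_nonneg

theorem clusterPairSum_eq_zero (J : V → V → ℝ) (A : Finset V) {o x : V} {S : Finset V}
    (ho : o ∈ S) (hx : x ∉ S) : clusterPairSum J A o x S = 0 := by
  refine sum_eq_zero_of_flip_fst S fun p => ?_
  rw [replicaCluster_flip_fst, replicaWeight_flip_fst]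
  simp only []
  rw [spin_flipOn_of_mem ho, spin_flipOn_of_notMem hx]
  ring

/-- The weight of the cluster `S` alone, summed against the spins at `o` and `x`. -/
def rootedClusterSum (J : V → V → ℝ) (o x : V) (S : Finset V) : ℝ :=
  ∑ p : (V → Bool) × (V → Bool), spin (p.1 o) * spin (p.1 x) * replicaCluster J o S p

theorem rootedClusterSum_nonneg {J : V → V → ℝ} (hJ : 0 ≤ J) (o x : V) (S : Finset V) :
    0 ≤ rootedClusterSum J o x S := by
  rw [rootedClusterSum, Fintype.sum_prod_type_right]
  exact Finset.sum_nonneg fun τ _ => (((SpinPositive.spin_apply o).mul (.spin_apply x)).mul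
    (SpinPositive.replicaCluster hJ o S τ)).sum_nonneg

theorem rootedClusterSum_mul_sum (J : V → V → ℝ) (A : Finset V) {o x : V} {S : Finset V}
    (ho : o ∈ S) (hx : x ∈ S) {Y : (V → Bool) × (V → Bool) → ℝ}
    (hY : SupportedOn (S : Set V)ᶜ Y) :
    rootedClusterSum J o x S * ∑ p, Y p * replicaWeight J (A \ S) p =
      (Fintype.card ((V → Bool) × (V → Bool)) : ℝ) *
        ∑ p, spin (p.1 o) * spin (p.1 x) * Y p *
          (replicaCluster J o S p * replicaWeight J (A \ S) p) := by
  rw [rootedClusterSum, sum_mul_sum_of_supportedOn (S := S)]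
  · congr 1
    exact Finset.sum_congr rfl fun p _ => by ring
  · intro p q h
    beta_reduce
    rw [(h o ho).1, (h x hx).1, replicaCluster_supportedOn J o S p q h]
  · intro p q h
    beta_reduce
    rw [hY p q h, replicaWeight_supportedOn J (A \ S) p q fun v hv => h v (by
      have : v ∉ S := (Finset.mem_sdiff.1 hv).2
      simpa using this)]

theorem rootedClusterSum_mul_partitionSum (J : V → V → ℝ) (A : Finset V) {o x : V}
    {S : Finset V} (ho : o ∈ S) (hx : x ∈ S) :
    rootedClusterSum J o x S * partitionSum J (A \ S) ^ 2 =
      (Fintype.card ((V → Bool) × (V → Bool)) : ℝ) * clusterPairSum J A o x S := by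
  have h := rootedClusterSum_mul_sum J A ho hx (Y := fun _ => 1) fun _ _ _ => rfl
  rw [sq, partitionSum, isingSum_mul_isingSum]
  simpa [clusterPairSum] using h

theorem four_point_eq (J : V → V → ℝ) (o x y z : V) :
    isingSum J Finset.univ (fun σ => spin (σ o) * spin (σ x) * spin (σ y) * spin (σ z)) *
          partitionSum J Finset.univ +
        pairSum J Finset.univ o x * pairSum J Finset.univ y z -
        pairSum J Finset.univ o y * pairSum J Finset.univ x z -
        pairSum J Finset.univ o z * pairSum J Finset.univ x y =
      2 * ∑ S ∈ Finset.univ.powerset with o ∈ S,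
        correlation J (Finset.univ \ S) y z * clusterPairSum J Finset.univ o x S := by
  rw [mul_comm (pairSum J Finset.univ o y), mul_comm (pairSum J Finset.univ o z)]
  simp only [pairSum, partitionSum, isingSum_mul_isingSum]
  rw [← Finset.sum_add_distrib, ← Finset.sum_sub_distrib, ← Finset.sum_sub_distrib]
  have e : ∀ p : (V → Bool) × (V → Bool),
      spin (p.1 o) * spin (p.1 x) * spin (p.1 y) * spin (p.1 z) * 1 *
            replicaWeight J Finset.univ p +
          spin (p.1 o) * spin (p.1 x) * (spin (p.1 y == p.2 y) * spin (p.1 z == p.2 z)) *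
            replicaWeight J Finset.univ p -
          spin (p.1 x) * spin (p.1 z) * (spin (p.1 o == p.2 o) * spin (p.1 y == p.2 y)) *
            replicaWeight J Finset.univ p -
          spin (p.1 x) * spin (p.1 y) * (spin (p.1 o == p.2 o) * spin (p.1 z == p.2 z)) *
            replicaWeight J Finset.univ p =
        spin (p.1 o) * spin (p.1 x) * (spin (p.1 y) * spin (p.1 z)) *
          ((1 - spin (p.2 o) * spin (p.2 y)) * (1 - spin (p.2 o) * spin (p.2 z))) *
            replicaWeight J Finset.univ p := by
    intro p
    simp only [spin_beq]
    linear_combination (-(spin (p.1 o) * spin (p.1 x) * spin (p.1 y) * spin (p.1 z) *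
      spin (p.2 y) * spin (p.2 z) * replicaWeight J Finset.univ p)) * spin_mul_self (p.2 o)
  simp only [e]
  rw [sum_mul_replicaWeight J (Finset.mem_univ o), Finset.mul_sum]
  refine Finset.sum_congr rfl fun S hS => ?_
  have ho : o ∈ S := (Finset.mem_filter.1 hS).2
  have hoc : o ∉ Sᶜ := by simpa using ho
  by_cases hyz : y ∈ S ∨ z ∈ S
  · have hc : correlation J (Finset.univ \ S) y z = 0 := by
      rw [correlation, if_neg]
      simp only [Finset.mem_sdiff, Finset.mem_univ, true_and]
      tauto
    rw [hc, zero_mul, mul_zero]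
    refine Finset.sum_eq_zero fun p _ => ?_
    rcases hyz with h | h
    · linear_combination (-(spin (p.1 o) * spin (p.1 x) * (spin (p.1 y) * spin (p.1 z)) *
        (1 - spin (p.2 o) * spin (p.2 z)) * replicaWeight J (Finset.univ \ S) p)) *
        replicaCluster_mul_spin (J := J) (o := o) h p
    · linear_combination (-(spin (p.1 o) * spin (p.1 x) * (spin (p.1 y) * spin (p.1 z)) *
        (1 - spin (p.2 o) * spin (p.2 y)) * replicaWeight J (Finset.univ \ S) p)) *
        replicaCluster_mul_spin (J := J) (o := o) h p
  obtain ⟨hy, hz⟩ := not_or.1 hyz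
  by_cases hx : x ∈ S
  · have hodd : ∑ p : (V → Bool) × (V → Bool),
        spin (p.1 o) * spin (p.1 x) * (spin (p.1 y) * spin (p.1 z)) *
          (spin (p.2 o) * (spin (p.2 y) + spin (p.2 z))) *
            (replicaCluster J o S p * replicaWeight J (Finset.univ \ S) p) = 0 := by
      refine sum_eq_zero_of_flip_snd Sᶜ fun p => ?_
      rw [replicaCluster_flip_snd, replicaWeight_flip_snd]
      simp only []
      rw [spin_flipOn_of_mem (Finset.mem_compl.2 hy), spin_flipOn_of_mem (Finset.mem_compl.2 hz),
        spin_flipOn_of_notMem hoc]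
      ring
    have hfac := rootedClusterSum_mul_sum J Finset.univ ho hx
      (Y := fun p => spin (p.1 y) * spin (p.1 z) * (1 + spin (p.2 y) * spin (p.2 z)))
      (fun p q h => by
        have h₁ := h y (by simpa using hy)
        have h₂ := h z (by simpa using hz)
        simp only [h₁, h₂])
    have hpair : ∑ p : (V → Bool) × (V → Bool),
        spin (p.1 y) * spin (p.1 z) * (1 + spin (p.2 y) * spin (p.2 z)) *
          replicaWeight J (Finset.univ \ S) p =
        2 * (pairSum J (Finset.univ \ S) y z * partitionSum J (Finset.univ \ S)) := by
      have h₁ := isingSum_mul_isingSum J (Finset.univ \ S)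
        (fun σ => spin (σ y) * spin (σ z)) fun _ => 1
      have h₂ := isingSum_mul_isingSum J (Finset.univ \ S)
        (fun _ => 1) fun σ => spin (σ y) * spin (σ z)
      rw [two_mul]
      nth_rewrite 2 [mul_comm]
      rw [pairSum, partitionSum, h₁, h₂, ← Finset.sum_add_distrib]
      refine Finset.sum_congr rfl fun p _ => ?_
      simp only [spin_beq]
      ring
    have hpart := rootedClusterSum_mul_partitionSum J Finset.univ ho hx
    have hcorr : correlation J (Finset.univ \ S) y z * partitionSum J (Finset.univ \ S) =
        pairSum J (Finset.univ \ S) y z := by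
      rw [correlation, if_pos (by simp [hy, hz]), div_mul_cancel₀ _ (partitionSum_pos _ _).ne']
    have hN : (Fintype.card ((V → Bool) × (V → Bool)) : ℝ) ≠ 0 :=
      Nat.cast_ne_zero.2 Fintype.card_ne_zero
    refine mul_left_cancel₀ hN ?_
    rw [hpair, ← hcorr] at hfac
    have hsplit : ∑ p : (V → Bool) × (V → Bool),
        spin (p.1 o) * spin (p.1 x) * (spin (p.1 y) * spin (p.1 z)) *
          ((1 - spin (p.2 o) * spin (p.2 y)) * (1 - spin (p.2 o) * spin (p.2 z))) *
            (replicaCluster J o S p * replicaWeight J (Finset.univ \ S) p) =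
        ∑ p : (V → Bool) × (V → Bool), spin (p.1 o) * spin (p.1 x) *
          (spin (p.1 y) * spin (p.1 z) * (1 + spin (p.2 y) * spin (p.2 z))) *
            (replicaCluster J o S p * replicaWeight J (Finset.univ \ S) p) := by
      rw [← sub_zero (∑ p : (V → Bool) × (V → Bool), spin (p.1 o) * spin (p.1 x) *
          (spin (p.1 y) * spin (p.1 z) * (1 + spin (p.2 y) * spin (p.2 z))) *
            (replicaCluster J o S p * replicaWeight J (Finset.univ \ S) p)), ← hodd,
        ← Finset.sum_sub_distrib]
      refine Finset.sum_congr rfl fun p _ => ?_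
      linear_combination (spin (p.1 o) * spin (p.1 x) * spin (p.1 y) * spin (p.1 z) *
        spin (p.2 y) * spin (p.2 z) *
        (replicaCluster J o S p * replicaWeight J (Finset.univ \ S) p)) * spin_mul_self (p.2 o)
    rw [hsplit, ← hfac]
    linear_combination 2 * correlation J (Finset.univ \ S) y z * hpart
  · rw [clusterPairSum_eq_zero J _ ho hx, mul_zero, mul_zero]
    refine sum_eq_zero_of_flip_fst S fun p => ?_
    rw [replicaCluster_flip_fst, replicaWeight_flip_fst]
    simp only []
    rw [spin_flipOn_of_mem ho, spin_flipOn_of_notMem hx, spin_flipOn_of_notMem hy,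
      spin_flipOn_of_notMem hz]
    ring

end Replica

section Inequalities

set_option linter.unusedSectionVars false

variable {V : Type*} [Fintype V] [DecidableEq V]

/-- Griffiths' first inequality: expectations of spin-positive functions increase with the
couplings, before normalisation. -/
theorem sum_mul_pairWeight_mono {a b : V → V → ℝ} (ha : 0 ≤ a) (hab : a ≤ b)
    {F : (V → Bool) → ℝ} (hF : SpinPositive F) :
    ∑ σ, F σ * pairWeight a σ ≤ ∑ σ, F σ * pairWeight b σ := by
  rw [← sub_nonneg, ← Finset.sum_sub_distrib]
  refine ((hF.mul (.pairWeight ha)).mul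
    (.pairWeight_sub_one (sub_nonneg.2 hab))).sum_nonneg.trans_eq
    (Finset.sum_congr rfl fun σ _ => ?_)
  have h := pairWeight_add a (b - a) σ
  rw [add_sub_cancel] at h
  rw [h]
  ring

theorem restrictCoupling_mono {J : V → V → ℝ} (hJ : 0 ≤ J) {A B : Finset V} (h : A ⊆ B) :
    restrictCoupling J A ≤ restrictCoupling J B := by
  intro u v
  by_cases hA : u ∈ A ∧ v ∈ A
  · simp [restrictCoupling, hA, h hA.1, h hA.2]
  · rw [restrictCoupling, if_neg hA]
    exact restrictCoupling_nonneg hJ B u v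

theorem spinPositive_pair (x y : V) :
    SpinPositive fun σ : V → Bool => spin (σ x) * spin (σ y) :=
  (SpinPositive.spin_apply x).mul (.spin_apply y)

theorem pairSum_nonneg {J : V → V → ℝ} (hJ : 0 ≤ J) (A : Finset V) (x y : V) :
    0 ≤ pairSum J A x y :=
  ((spinPositive_pair x y).mul (.pairWeight (restrictCoupling_nonneg hJ A))).sum_nonneg

theorem correlation_nonneg {J : V → V → ℝ} (hJ : 0 ≤ J) (A : Finset V) (x y : V) :
    0 ≤ correlation J A x y := by
  rw [correlation]
  split_ifs
  exacts [div_nonneg (pairSum_nonneg hJ A x y) (partitionSum_pos J A).le, le_rfl]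

theorem correlation_comm (J : V → V → ℝ) (A : Finset V) (x y : V) :
    correlation J A x y = correlation J A y x := by
  simp only [correlation, pairSum, mul_comm, and_comm]

theorem correlation_self (J : V → V → ℝ) {A : Finset V} {x : V} (hx : x ∈ A) :
    correlation J A x x = 1 := by
  simp only [correlation, hx, and_self, if_true, pairSum, spin_mul_self]
  exact div_self (partitionSum_pos J A).ne'

theorem correlation_mono {J : V → V → ℝ} (hJ : 0 ≤ J) {A B : Finset V} (hAB : A ⊆ B)
    (x y : V) : correlation J A x y ≤ correlation J B x y := by
  by_cases h : x ∈ A ∧ y ∈ A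
  · rw [correlation, correlation, if_pos h, if_pos ⟨hAB h.1, hAB h.2⟩,
      div_le_div_iff₀ (partitionSum_pos J A) (partitionSum_pos J B)]
    have hd : 0 ≤ restrictCoupling J B - restrictCoupling J A :=
      sub_nonneg.2 (restrictCoupling_mono hJ hAB)
    have e : ∀ σ, pairWeight (restrictCoupling J B) σ =
        pairWeight (restrictCoupling J B - restrictCoupling J A) σ *
          pairWeight (restrictCoupling J A) σ := fun σ => by
      rw [← pairWeight_add, sub_add_cancel]
    have key := griffiths_second (restrictCoupling_nonneg hJ A) (spinPositive_pair x y)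
      (.pairWeight hd)
    simpa only [pairSum, partitionSum, isingSum, e, one_mul, mul_assoc] using key
  · rw [correlation, if_neg h]
    exact correlation_nonneg hJ B x y

/-- The partition function is log-supermodular in the volume. -/
theorem partitionSum_mul_partitionSum_le {J : V → V → ℝ} (hJ : 0 ≤ J) (P Q : Finset V) :
    partitionSum J P * partitionSum J Q ≤ partitionSum J (P ∪ Q) * partitionSum J (P ∩ Q) := by
  set a := restrictCoupling J (P ∩ Q) with ha
  have hP : 0 ≤ restrictCoupling J P - a :=
    sub_nonneg.2 (restrictCoupling_mono hJ Finset.inter_subset_left)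
  have hQ : 0 ≤ restrictCoupling J Q - a :=
    sub_nonneg.2 (restrictCoupling_mono hJ Finset.inter_subset_right)
  have ha0 : 0 ≤ a := restrictCoupling_nonneg hJ _
  have key := griffiths_second ha0 (.pairWeight hP) (.pairWeight hQ)
  simp only [← pairWeight_add, sub_add_cancel] at key
  have hle : restrictCoupling J P - a + (restrictCoupling J Q - a) + a ≤
      restrictCoupling J (P ∪ Q) := by
    intro u v
    have := hJ u v
    simp only [ha, restrictCoupling, Pi.add_apply, Pi.sub_apply, Finset.mem_union,
      Finset.mem_inter]
    by_cases hu : u ∈ P <;> by_cases hv : v ∈ P <;> by_cases hu' : u ∈ Q <;>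
      by_cases hv' : v ∈ Q <;> simp [hu, hv, hu', hv'] <;> exact this
  have hmono := sum_mul_pairWeight_mono (add_nonneg (add_nonneg hP hQ) ha0) hle
    (.const (V := V) zero_le_one)
  simp only [one_mul] at hmono
  simp only [partitionSum, isingSum, one_mul]
  exact key.trans (mul_le_mul_of_nonneg_right hmono
    (Finset.sum_nonneg fun σ _ => (pairWeight_pos _ σ).le))

theorem clusterPairSum_erase_le {J : V → V → ℝ} (hJ : 0 ≤ J) {A S : Finset V} {x y : V}
    (hy : y ∈ A) (hS : S ⊆ A.erase y) (hx : x ∈ S) (z : V) :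
    clusterPairSum J A x z S * partitionSum J (A.erase y) ^ 2 ≤
      clusterPairSum J (A.erase y) x z S * partitionSum J A ^ 2 := by
  by_cases hz : z ∈ S
  · have hN : (0 : ℝ) < Fintype.card ((V → Bool) × (V → Bool)) :=
      Nat.cast_pos.2 Fintype.card_pos
    refine le_of_mul_le_mul_left ?_ hN
    have h := partitionSum_mul_partitionSum_le hJ (A \ S) (A.erase y)
    have hyS : y ∉ S := fun h => by simpa using hS h
    have hu : A \ S ∪ A.erase y = A := by
      ext v
      by_cases hv : v = y
      · simp [hv, hy, hyS]
      · simp only [Finset.mem_union, Finset.mem_sdiff, Finset.mem_erase]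
        tauto
    have hi : A \ S ∩ A.erase y = A.erase y \ S := by
      ext v
      simp only [Finset.mem_inter, Finset.mem_sdiff, Finset.mem_erase]
      tauto
    rw [hu, hi] at h
    have hsq := pow_le_pow_left₀
      (mul_pos (partitionSum_pos J _) (partitionSum_pos J _)).le h 2
    rw [mul_pow, mul_pow] at hsq
    have hm := mul_le_mul_of_nonneg_left hsq (rootedClusterSum_nonneg hJ x z S)
    rw [← mul_assoc, ← mul_assoc, ← rootedClusterSum_mul_partitionSum J A hx hz,
      ← rootedClusterSum_mul_partitionSum J (A.erase y) hx hz]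
    linarith
  · rw [clusterPairSum_eq_zero J _ hx hz, clusterPairSum_eq_zero J _ hx hz]
    simp

/-- Deleting the vertex `y` lowers `⟨σ_x σ_z⟩` by at most `⟨σ_x σ_y⟩⟨σ_z σ_y⟩`. -/
theorem correlation_sub_erase_le {J : V → V → ℝ} (hJ : 0 ≤ J) {A : Finset V} {y : V}
    (hy : y ∈ A) (x z : V) :
    correlation J A x z - correlation J (A.erase y) x z ≤
      correlation J A x y * correlation J A z y := by
  by_cases hA : x ∈ A ∧ z ∈ A
  swap
  · have : correlation J A x z = 0 := by rw [correlation, if_neg hA]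
    rw [this]
    linarith [correlation_nonneg hJ (A.erase y) x z,
      mul_nonneg (correlation_nonneg hJ A x y) (correlation_nonneg hJ A z y)]
  obtain ⟨hxA, hzA⟩ := hA
  by_cases hxy : x = y
  · subst hxy
    rw [correlation_self J hxA, one_mul, correlation_comm J A z]
    linarith [correlation_nonneg hJ (A.erase x) x z]
  by_cases hzy : z = y
  · subst hzy
    rw [correlation_self J hzA, mul_one]
    linarith [correlation_nonneg hJ (A.erase z) x z]
  have hx' : x ∈ A.erase y := Finset.mem_erase.2 ⟨hxy, hxA⟩
  have hz' : z ∈ A.erase y := Finset.mem_erase.2 ⟨hzy, hzA⟩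
  have hdiff : pairSum J A x z * partitionSum J A - pairSum J A x y * pairSum J A z y =
      ∑ S ∈ (A.erase y).powerset with x ∈ S, clusterPairSum J A x z S := by
    rw [partitionSum_mul_pairSum J hxA, pairSum_mul_pairSum J hxA, ← Finset.sum_sub_distrib]
    symm
    refine Finset.sum_subset_zero_on_sdiff (fun S hS => ?_) (fun S hS => ?_) fun S hS => ?_
    · simp only [Finset.mem_filter, Finset.mem_powerset] at hS ⊢
      exact ⟨hS.1.trans (Finset.erase_subset _ _), hS.2⟩
    · simp only [Finset.mem_sdiff, Finset.mem_filter, Finset.mem_powerset,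
        Finset.subset_erase] at hS
      rw [if_pos (by tauto), sub_self]
    · simp only [Finset.mem_filter, Finset.mem_powerset, Finset.subset_erase] at hS
      rw [if_neg hS.1.2, sub_zero]
  have hsum : (∑ S ∈ (A.erase y).powerset with x ∈ S, clusterPairSum J A x z S) *
        partitionSum J (A.erase y) ^ 2 ≤
      (pairSum J (A.erase y) x z * partitionSum J (A.erase y)) * partitionSum J A ^ 2 := by
    rw [partitionSum_mul_pairSum J hx', Finset.sum_mul, Finset.sum_mul]
    refine Finset.sum_le_sum fun S hS => ?_
    obtain ⟨hS, hxS⟩ := Finset.mem_filter.1 hS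
    exact clusterPairSum_erase_le hJ hy (Finset.mem_powerset.1 hS) hxS z
  rw [← hdiff] at hsum
  have hZ := partitionSum_pos J A
  have hZ' := partitionSum_pos J (A.erase y)
  simp only [correlation, hxA, hzA, hy, hx', hz', and_self, if_true]
  rw [sub_le_comm, ← mul_le_mul_iff_left₀ (mul_pos (pow_pos hZ 2) (pow_pos hZ' 2))]
  have hl : (pairSum J A x z / partitionSum J A - pairSum J A x y / partitionSum J A *
        (pairSum J A z y / partitionSum J A)) *
        (partitionSum J A ^ 2 * partitionSum J (A.erase y) ^ 2) =
      (pairSum J A x z * partitionSum J A - pairSum J A x y * pairSum J A z y) *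
        partitionSum J (A.erase y) ^ 2 := by
    field_simp
  have hr : pairSum J (A.erase y) x z / partitionSum J (A.erase y) *
        (partitionSum J A ^ 2 * partitionSum J (A.erase y) ^ 2) =
      pairSum J (A.erase y) x z * partitionSum J (A.erase y) * partitionSum J A ^ 2 := by
    field_simp
  rwa [hl, hr]

theorem correlation_sub_sdiff_le {J : V → V → ℝ} (hJ : 0 ≤ J) (x z : V) (S : Finset V) :
    correlation J Finset.univ x z - correlation J (Finset.univ \ S) x z ≤
      ∑ y ∈ S, correlation J Finset.univ x y * correlation J Finset.univ z y := by
  induction S using Finset.induction_on with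
  | empty => simp
  | insert y S hy ih =>
    rw [Finset.sum_insert hy, Finset.sdiff_insert]
    have h := correlation_sub_erase_le hJ (A := Finset.univ \ S) (by simpa using hy) x z
    have hm := mul_le_mul (correlation_mono hJ (Finset.subset_univ (Finset.univ \ S)) x y)
      (correlation_mono hJ (Finset.subset_univ (Finset.univ \ S)) z y)
      (correlation_nonneg hJ _ z y) (correlation_nonneg hJ _ x y)
    linarith

/-- The tree bound for an Ising model with arbitrary ferromagnetic pair couplings. -/
theorem abs_ursell_le {J : V → V → ℝ} (hJ : 0 ≤ J) (o x y z : V) :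
    |isingSum J Finset.univ (fun σ => spin (σ o) * spin (σ x) * spin (σ y) * spin (σ z)) /
            partitionSum J Finset.univ -
          correlation J Finset.univ o x * correlation J Finset.univ y z -
        correlation J Finset.univ o y * correlation J Finset.univ x z -
      correlation J Finset.univ o z * correlation J Finset.univ x y| ≤
    2 * ∑ v, correlation J Finset.univ o v * correlation J Finset.univ x v *
      correlation J Finset.univ y v * correlation J Finset.univ z v := by
  set Z := partitionSum J Finset.univ with hZdef
  have hZ : 0 < Z := partitionSum_pos J _
  have hY : ∀ u v, pairSum J Finset.univ u v = correlation J Finset.univ u v * Z := by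
    intro u v
    rw [correlation, if_pos (by simp), div_mul_cancel₀ _ hZ.ne']
  have hfour := four_point_eq J o x y z
  have htwo := partitionSum_mul_pairSum J (Finset.mem_univ o) x
  have hthree := fun v => pairSum_mul_pairSum J (Finset.mem_univ o) x v
  simp only [hY, ← hZdef] at hfour htwo hthree
  set I := isingSum J Finset.univ fun σ => spin (σ o) * spin (σ x) * spin (σ y) * spin (σ z)
  set 𝒮 : Finset (Finset V) := {S ∈ (Finset.univ : Finset V).powerset | o ∈ S}
  have hU : (I / Z - correlation J Finset.univ o x * correlation J Finset.univ y z -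
        correlation J Finset.univ o y * correlation J Finset.univ x z -
      correlation J Finset.univ o z * correlation J Finset.univ x y) * Z ^ 2 =
      -(2 * ∑ S ∈ 𝒮, (correlation J Finset.univ y z - correlation J (Finset.univ \ S) y z) *
        clusterPairSum J Finset.univ o x S) := by
    simp only [sub_mul, Finset.sum_sub_distrib]
    rw [← Finset.mul_sum, ← htwo]
    have : I / Z * Z ^ 2 = I * Z := by field_simp
    rw [this]
    linear_combination hfour
  have hK := fun S => clusterPairSum_nonneg hJ Finset.univ o x S
  have hlow : 0 ≤ ∑ S ∈ 𝒮,
      (correlation J Finset.univ y z - correlation J (Finset.univ \ S) y z) *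
        clusterPairSum J Finset.univ o x S :=
    Finset.sum_nonneg fun S _ => mul_nonneg
      (sub_nonneg.2 (correlation_mono hJ (Finset.subset_univ _) y z)) (hK S)
  have hup : ∑ S ∈ 𝒮, (correlation J Finset.univ y z - correlation J (Finset.univ \ S) y z) *
        clusterPairSum J Finset.univ o x S ≤
      (∑ v, correlation J Finset.univ o v * correlation J Finset.univ x v *
        correlation J Finset.univ y v * correlation J Finset.univ z v) * Z ^ 2 := by
    calc _ ≤ ∑ S ∈ 𝒮, (∑ v ∈ S, correlation J Finset.univ y v * correlation J Finset.univ z v) *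
          clusterPairSum J Finset.univ o x S :=
          Finset.sum_le_sum fun S _ =>
            mul_le_mul_of_nonneg_right (correlation_sub_sdiff_le hJ y z S) (hK S)
      _ = ∑ S ∈ 𝒮, ∑ v, correlation J Finset.univ y v * correlation J Finset.univ z v *
          (if v ∈ S then clusterPairSum J Finset.univ o x S else 0) := by
          refine Finset.sum_congr rfl fun S _ => ?_
          simp [Finset.sum_mul, Finset.sum_ite_mem]
      _ = _ := by
          rw [Finset.sum_comm, Finset.sum_mul]
          refine Finset.sum_congr rfl fun v _ => ?_
          rw [← Finset.mul_sum, ← hthree]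
          ring
  refine le_of_mul_le_mul_right ?_ (pow_pos hZ 2)
  rw [← abs_of_pos (pow_pos hZ 2), ← abs_mul, abs_of_pos (pow_pos hZ 2), hU, abs_neg,
    abs_of_nonneg (mul_nonneg zero_le_two hlow)]
  linarith

end Inequalities

/-- tree bound on the four-point Ursell function.  For the
nearest-neighbour ferromagnetic Ising model on a finite set `Λ ⊆ ℤ^d` at inverse
temperature `β ≥ 0`, the fourth joint cumulant
`U₄(x₁,…,x₄) = ⟨σ_{x₁}⋯σ_{x₄}⟩ - C(x₁,x₂)C(x₃,x₄) - C(x₁,x₃)C(x₂,x₄) - C(x₁,x₄)C(x₂,x₃)`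
satisfies `|U₄| ≤ 2 ∑_{y ∈ Λ} C(x₁,y)C(x₂,y)C(x₃,y)C(x₄,y)`. -/
theorem tree_bound (d : ℕ) (hd : 1 ≤ d) (Λ : Finset (Fin d → ℤ)) (β : ℝ) (hβ : 0 ≤ β)
    (x₁ x₂ x₃ x₄ : {x // x ∈ Λ}) :
    |isingExp Λ β (fun σ => spin (σ x₁) * spin (σ x₂) * spin (σ x₃) * spin (σ x₄)) -
        twoPoint Λ β x₁ x₂ * twoPoint Λ β x₃ x₄ -
        twoPoint Λ β x₁ x₃ * twoPoint Λ β x₂ x₄ -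
        twoPoint Λ β x₁ x₄ * twoPoint Λ β x₂ x₃| ≤
      2 * ∑ y ∈ Λ.attach,
        twoPoint Λ β x₁ y * twoPoint Λ β x₂ y * twoPoint Λ β x₃ y * twoPoint Λ β x₄ y := by
  set J : {x // x ∈ Λ} → {x // x ∈ Λ} → ℝ := fun u v =>
    if dist1 (u : Fin d → ℤ) (v : Fin d → ℤ) = 1 then β / 2 else 0 with hJdef
  have hJ : 0 ≤ J := by
    intro u v
    simp only [hJdef, Pi.zero_apply]
    split_ifs <;> linarith
  have hw : ∀ σ, isingWeight Λ β σ = pairWeight (restrictCoupling J Finset.univ) σ := by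
    intro σ
    simp only [isingWeight, pairWeight, ← mul_assoc, Finset.mul_sum, Finset.univ_eq_attach]
    congr 1
    refine Finset.sum_congr rfl fun u _ => Finset.sum_congr rfl fun v _ => ?_
    by_cases h : dist1 (u : Fin d → ℤ) (v : Fin d → ℤ) = 1 <;>
      simp [restrictCoupling, hJdef, h, div_eq_mul_inv, mul_assoc]
  have hexp : ∀ f, isingExp Λ β f =
      isingSum J Finset.univ f / partitionSum J Finset.univ := by
    intro f
    simp only [isingExp, isingSum, partitionSum, hw, one_mul, mul_comm]
  have hcorr : ∀ x y, twoPoint Λ β x y = correlation J Finset.univ x y := by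
    intro x y
    rw [twoPoint, hexp, correlation, if_pos (by simp), pairSum]
  simp only [hcorr, hexp, ← Finset.univ_eq_attach]
  exact abs_ursell_le hJ x₁ x₂ x₃ x₄

end
end
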